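/- arXiv:1706.03109 — 2 statements merged into one kernel-verified Lean document; each statement's English description precedes it below -/
import Mathlib

section
/- For every integer t ≥ 1, the outerthickness of the complete graph K_{4t} equals t+1. -/
open SimpleGraph

/-- A graph is planar if it has a drawing in the plane: vertices map injectively to points,
edges map to arcs between their endpoints, arc interiors avoid vertex images, and the
interiors of arcs of distinct edges are disjoint. -/
def SimpleGraph.IsPlanar {V : Type*} (G : SimpleGraph V) : Prop :=
  ∃ f : V → ℝ × ℝ, Function.Injective f ∧
    ∃ γ : ∀ ⦃u v : V⦄, G.Adj u v → _root_.Path (f u) (f v),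
      (∀ ⦃u v : V⦄ (h : G.Adj u v), Function.Injective (γ h)) ∧
      (∀ ⦃u v : V⦄ (h : G.Adj u v) (t : unitInterval), t ≠ 0 → t ≠ 1 → ∀ w, γ h t ≠ f w) ∧
      (∀ ⦃u v u' v' : V⦄ (h : G.Adj u v) (h' : G.Adj u' v'), s(u, v) ≠ s(u', v') →
        ∀ s t : unitInterval, s ≠ 0 → s ≠ 1 → γ h s ≠ γ h' t)

/-- The cone over `G`: a new vertex `none` joined to every vertex of `G`. -/
def SimpleGraph.cone {V : Type*} (G : SimpleGraph V) : SimpleGraph (Option V) :=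
  SimpleGraph.fromRel
    (fun x y => (∃ u v, x = some u ∧ y = some v ∧ G.Adj u v) ∨ x = none)

/-- A graph is outerplanar iff the cone over it is planar. -/
def SimpleGraph.IsOuterplanar {V : Type*} (G : SimpleGraph V) : Prop :=
  G.cone.IsPlanar

/-- A complete `k`-coloring: surjective, and every pair of distinct colors appears on an edge. -/
def SimpleGraph.IsCompleteColoring {V : Type*} {k : ℕ} (G : SimpleGraph V)
    (c : V → Fin k) : Prop :=
  Function.Surjective c ∧
    ∀ i j : Fin k, i ≠ j → ∃ u v, G.Adj u v ∧ c u = i ∧ c v = j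

/-- A proper coloring: adjacent vertices receive distinct colors. -/
def SimpleGraph.IsProperColoring {V : Type*} {k : ℕ} (G : SimpleGraph V)
    (c : V → Fin k) : Prop :=
  ∀ ⦃u v : V⦄, G.Adj u v → c u ≠ c v

/-- The pseudoachromatic number: the largest `k` admitting a complete `k`-coloring. -/
noncomputable def SimpleGraph.pseudoachromatic {V : Type*} (G : SimpleGraph V) : ℕ :=
  sSup {k | ∃ c : V → Fin k, G.IsCompleteColoring c}

/-- The achromatic number: the largest `k` admitting a proper complete `k`-coloring. -/
noncomputable def SimpleGraph.achromatic {V : Type*} (G : SimpleGraph V) : ℕ :=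
  sSup {k | ∃ c : V → Fin k, G.IsProperColoring c ∧ G.IsCompleteColoring c}

/-- The chromatic number: the least `k` admitting a proper `k`-coloring. -/
noncomputable def SimpleGraph.chromNum {V : Type*} (G : SimpleGraph V) : ℕ :=
  sInf {k | ∃ c : V → Fin k, G.IsProperColoring c}

/-- The thickness: the least number of planar subgraphs whose union is `G`. -/
noncomputable def SimpleGraph.thickness {V : Type*} (G : SimpleGraph V) : ℕ :=
  sInf {k | ∃ f : Fin k → SimpleGraph V, (∀ i, (f i).IsPlanar) ∧ (⨆ i, f i) = G}

/-- The outerthickness: the least number of outerplanar subgraphs whose union is `G`. -/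
noncomputable def SimpleGraph.outerthickness {V : Type*} (G : SimpleGraph V) : ℕ :=
  sInf {k | ∃ f : Fin k → SimpleGraph V, (∀ i, (f i).IsOuterplanar) ∧ (⨆ i, f i) = G}

/-- The 4-girth-thickness: the least number of planar subgraphs of girth at least 4
whose union is `G`. -/
noncomputable def SimpleGraph.girth4Thickness {V : Type*} (G : SimpleGraph V) : ℕ :=
  sInf {k | ∃ f : Fin k → SimpleGraph V,
    (∀ i, (f i).IsPlanar ∧ 4 ≤ (f i).egirth) ∧ (⨆ i, f i) = G}
/-- The change `L 1 - L 0` of a continuous logarithm along a path depends only on the path. -/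
theorem Complex.sub_eq_sub_of_exp_comp_eq {L L' : ℝ → ℂ} (hL : Continuous L) (hL' : Continuous L')
    (h : ∀ s, Complex.exp (L s) = Complex.exp (L' s)) : L 1 - L 0 = L' 1 - L' 0 := by
  obtain ⟨F, -, hF⟩ := Complex.isCoveringMapOn_exp.existsUnique_continuousMap_lifts
    (f := ⟨fun s => Complex.exp (L s), by fun_prop⟩) (a₀ := (0 : ℝ)) (e₀ := L 0) rfl
    (fun a => by simp)
  have h₁ := hF ⟨L, hL⟩ ⟨rfl, rfl⟩
  have h₂ := hF ⟨fun s => L' s + (L 0 - L' 0), by fun_prop⟩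
    ⟨by simp, by ext s; simp [Complex.exp_add, Complex.exp_sub, h]⟩
  have h₃ : L 1 = L' 1 + (L 0 - L' 0) := by
    simpa using congrArg (fun G : C(ℝ, ℂ) => G 1) (h₁.trans h₂.symm)
  rw [h₃]; ring

/-- A nonvanishing continuous function on a vector space has a continuous logarithm. -/
theorem Complex.exists_continuous_exp_eq {E : Type*} [NormedAddCommGroup E] [NormedSpace ℝ E]
    {g : E → ℂ} (hg : Continuous g) (h : ∀ s, g s ≠ 0) :
    ∃ L : E → ℂ, Continuous L ∧ ∀ s, Complex.exp (L s) = g s := by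
  obtain ⟨F, ⟨-, hF⟩, -⟩ := Complex.isCoveringMapOn_exp.existsUnique_continuousMap_lifts
    (f := ⟨g, hg⟩) (a₀ := (0 : E)) (e₀ := Complex.log (g 0)) (Complex.exp_log (h 0))
    (fun a => by simpa using h a)
  exact ⟨F, F.continuous, fun s => congrFun hF s⟩

/-- `IsLogChange g z δ`: the logarithm of `g - z` changes by `δ` along `g` from `0` to `1`. -/
def IsLogChange (g : ℝ → ℂ) (z δ : ℂ) : Prop :=
  ∃ L : ℝ → ℂ, Continuous L ∧ (∀ s, Complex.exp (L s) = g s - z) ∧ δ = L 1 - L 0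

theorem exists_isLogChange {g : ℝ → ℂ} (hg : Continuous g) {z : ℂ} (h : ∀ s, g s ≠ z) :
    ∃ δ, IsLogChange g z δ := by
  obtain ⟨L, hL, h'⟩ := Complex.exists_continuous_exp_eq (g := fun s => g s - z) (by fun_prop)
    (fun s => sub_ne_zero.2 (h s))
  exact ⟨_, L, hL, h', rfl⟩

/-- Around the boundary of the square, the logarithm of `g s - k t` does not change. -/
theorem IsLogChange.add_eq_add {g k : ℝ → ℂ} (hg : Continuous g) (hk : Continuous k)
    (h : ∀ s t, g s ≠ k t) {δ₁ δ₂ δ₃ δ₄ : ℂ} (h₁ : IsLogChange g (k 0) δ₁)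
    (h₂ : IsLogChange k (g 1) δ₂) (h₃ : IsLogChange g (k 1) δ₃) (h₄ : IsLogChange k (g 0) δ₄) :
    δ₁ + δ₂ = δ₃ + δ₄ := by
  obtain ⟨F, hF, hF'⟩ := Complex.exists_continuous_exp_eq (E := ℝ × ℝ)
    (g := fun x => g x.1 - k x.2) (by fun_prop) (fun x => sub_ne_zero.2 (h _ _))
  have hor : ∀ t δ, IsLogChange g (k t) δ → δ = F (1, t) - F (0, t) := by
    rintro t δ ⟨L, hL, hL', rfl⟩
    exact Complex.sub_eq_sub_of_exp_comp_eq (L' := fun s => F (s, t)) hL (by fun_prop)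
      fun s => by rw [hL', hF']
  have ver : ∀ s δ, IsLogChange k (g s) δ → δ = F (s, 1) - F (s, 0) := by
    rintro s δ ⟨L, hL, hL', rfl⟩
    have := Complex.sub_eq_sub_of_exp_comp_eq (L := L)
      (L' := fun t => F (s, t) + Real.pi * Complex.I) hL (by fun_prop)
      fun t => by rw [hL', Complex.exp_add, hF', Complex.exp_pi_mul_I]; ring
    rw [this]; ring
  rw [hor _ _ h₁, ver _ _ h₂, hor _ _ h₃, ver _ _ h₄]
  ring

/-- In a drawing of `K₅` in the plane, some two disjoint edges meet. -/
theorem not_exists_drawing_completeGraph_five (p : Fin 5 → ℂ) (g : Fin 5 → Fin 5 → ℝ → ℂ)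
    (hg : ∀ i j, i ≠ j → Continuous (g i j)) (hg₀ : ∀ i j, i ≠ j → g i j 0 = p i)
    (hg₁ : ∀ i j, i ≠ j → g i j 1 = p j)
    (h : ∀ i j k l, i ≠ j → k ≠ l → i ≠ k → i ≠ l → j ≠ k → j ≠ l → ∀ s t, g i j s ≠ g k l t) :
    False := by
  have hgp : ∀ i j k, i ≠ j → i ≠ k → j ≠ k → ∀ s, g i j s ≠ p k := by
    intro i j k hij hik hjk s
    obtain ⟨l, hkl, hil, hjl⟩ : ∃ l, k ≠ l ∧ i ≠ l ∧ j ≠ l := by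
      revert i j k; decide
    rw [← hg₀ k l hkl]
    exact h i j k l hij hkl hik hil hjk hjl s 0
  have hp : ∀ i j, i ≠ j → p i ≠ p j := by
    intro i j hij
    obtain ⟨l, hil, hjl⟩ : ∃ l, i ≠ l ∧ l ≠ j := by
      revert i j; decide
    rw [← hg₀ i l hil]
    exact hgp i l j hil hij hjl 0
  let ε : Fin 5 → Fin 5 → ℤ := fun i j => if i < j then 1 else 0
  let β : Fin 5 → Fin 5 → ℂ := fun i j => Complex.log (p (max i j) - p (min i j))
  have hβ : ∀ i j, β i j = β j i := fun i j => by simp only [β, max_comm, min_comm]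
  have hexp : ∀ i j, i ≠ j →
      Complex.exp (β i j + Real.pi * Complex.I * ε i j) = p i - p j := by
    intro i j hij
    have hne := sub_ne_zero.2 (hp (max i j) (min i j) (by simpa using hij))
    rcases lt_or_gt_of_ne hij with hlt | hlt
    · simp only [β, ε, if_pos hlt, Complex.exp_add, Complex.exp_log hne]
      simp [max_eq_right hlt.le, min_eq_left hlt.le, Complex.exp_pi_mul_I]
    · simp only [β, ε, if_neg hlt.not_gt, Complex.exp_add, Complex.exp_log hne]
      simp [max_eq_left hlt.le, min_eq_right hlt.le]
  have hδ : ∀ i j k, ∃ n : ℤ, i ≠ j → i ≠ k → j ≠ k → IsLogChange (g i j) (p k)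
      ((β j k + Real.pi * Complex.I * ε j k) - (β i k + Real.pi * Complex.I * ε i k) +
        n * (2 * Real.pi * Complex.I)) := by
    intro i j k
    by_cases hne : i ≠ j ∧ i ≠ k ∧ j ≠ k
    · obtain ⟨hij, hik, hjk⟩ := hne
      obtain ⟨δ, hδ⟩ := exists_isLogChange (hg i j hij) (hgp i j k hij hik hjk)
      obtain ⟨L, -, hL, hδL⟩ := id hδ
      have h₀ := hL 0
      have h₁ := hL 1
      rw [hg₀ i j hij, ← hexp i k hik] at h₀
      rw [hg₁ i j hij, ← hexp j k hjk, Complex.exp_eq_exp_iff_exists_int] at h₁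
      obtain ⟨m₀, h₀⟩ := Complex.exp_eq_exp_iff_exists_int.1 h₀
      obtain ⟨m₁, h₁⟩ := h₁
      refine ⟨m₁ - m₀, fun _ _ _ => ?_⟩
      convert hδ using 1
      rw [hδL, h₀, h₁]
      push_cast
      ring
    · exact ⟨0, fun h₁ h₂ h₃ => absurd ⟨h₁, h₂, h₃⟩ hne⟩
  choose n hn using hδ
  have key : ∀ a b c d, a ≠ b → c ≠ d → a ≠ c → a ≠ d → b ≠ c → b ≠ d →
      (ε b c - ε c b) + (ε c a - ε a c) + (ε d b - ε b d) + (ε a d - ε d a) +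
        2 * (n a b c + n c d b - n a b d - n c d a) = 0 := by
    intro a b c d hab hcd hac had hbc hbd
    have := IsLogChange.add_eq_add (hg a b hab) (hg c d hcd) (h a b c d hab hcd hac had hbc hbd)
      (by rw [hg₀ c d hcd]; exact hn a b c hab hac hbc)
      (by rw [hg₁ a b hab]; exact hn c d b hcd hbc.symm hbd.symm)
      (by rw [hg₁ c d hcd]; exact hn a b d hab had hbd)
      (by rw [hg₀ a b hab]; exact hn c d a hcd hac.symm had.symm)
    have hpi : (Real.pi * Complex.I : ℂ) ≠ 0 := by simp [Real.pi_ne_zero]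
    have hz : (Real.pi * Complex.I : ℂ) * (((ε b c - ε c b) + (ε c a - ε a c) + (ε d b - ε b d) +
        (ε a d - ε d a) + 2 * (n a b c + n c d b - n a b d - n c d a) : ℤ) : ℂ) = 0 := by
      push_cast
      rw [hβ c a, hβ c b, hβ d a, hβ d b] at this
      linear_combination this
    exact_mod_cast (mul_eq_zero.1 hz).resolve_left hpi
  have h₁ := key 0 1 2 3
  have h₂ := key 0 1 2 4
  have h₃ := key 0 1 3 4
  have h₄ := key 0 2 1 3
  have h₅ := key 0 2 1 4
  have h₆ := key 0 2 3 4
  have h₇ := key 0 3 1 2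
  have h₈ := key 0 3 1 4
  have h₉ := key 0 3 2 4
  have h₁₀ := key 0 4 1 2
  have h₁₁ := key 0 4 1 3
  have h₁₂ := key 0 4 2 3
  have h₁₃ := key 1 2 3 4
  have h₁₄ := key 1 3 2 4
  have h₁₅ := key 1 4 2 3
  simp [ε] at h₁ h₂ h₃ h₄ h₅ h₆ h₇ h₈ h₉ h₁₀ h₁₁ h₁₂ h₁₃ h₁₄ h₁₅
  omega

namespace SimpleGraph

variable {V : Type*}

/-- A weakening of planarity inherited by minors: only disjoint edges are required to be drawn
disjointly. -/
def IsWeaklyPlanar (G : SimpleGraph V) : Prop :=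
  ∃ (f : V → ℂ) (E : V → V → Set ℂ), (∀ u v, G.Adj u v → JoinedIn (E u v) (f u) (f v)) ∧
    ∀ u v x y, G.Adj u v → G.Adj x y → u ≠ x → u ≠ y → v ≠ x → v ≠ y → Disjoint (E u v) (E x y)

theorem IsPlanar.isWeaklyPlanar {G : SimpleGraph V} (h : G.IsPlanar) : G.IsWeaklyPlanar := by
  obtain ⟨f, hf, γ, -, hv, he⟩ := h
  refine ⟨fun v => Complex.equivRealProdCLM.symm (f v),
    fun u v => {z | ∃ (h : G.Adj u v) (t : unitInterval), z = Complex.equivRealProdCLM.symm (γ h t)},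
    fun u v h => ⟨(γ h).map Complex.equivRealProdCLM.symm.continuous, fun t => ⟨h, t, rfl⟩⟩, ?_⟩
  intro u v x y h h' hux huy hvx hvy
  rw [Set.disjoint_left]
  rintro _ ⟨_, s, rfl⟩ ⟨_, t, ht⟩
  have ht := Complex.equivRealProdCLM.symm.injective ht
  by_cases hs : s = 0 ∨ s = 1
  · obtain ⟨w, hw, hwx, hwy⟩ : ∃ w, γ h s = f w ∧ w ≠ x ∧ w ≠ y := by
      rcases hs with rfl | rfl
      exacts [⟨u, by simp, hux, huy⟩, ⟨v, by simp, hvx, hvy⟩]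
    rw [hw] at ht
    by_cases h₀ : t = 0
    · subst h₀; exact hwx (hf (by simpa using ht))
    by_cases h₁ : t = 1
    · subst h₁; exact hwy (hf (by simpa using ht))
    exact hv h' t h₀ h₁ w ht.symm
  · push Not at hs
    exact he h h' (by simp; tauto) s t hs.1 hs.2 ht

theorem IsWeaklyPlanar.not_completeGraph_five {G : SimpleGraph V} (h : G.IsWeaklyPlanar)
    (w : Fin 5 → V) (hw : ∀ i j, i ≠ j → G.Adj (w i) (w j)) : False := by
  obtain ⟨f, E, hE, hd⟩ := h
  have hne : ∀ i j, i ≠ j → w i ≠ w j := fun i j hij => (hw i j hij).ne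
  refine not_exists_drawing_completeGraph_five (f ∘ w)
    (fun i j s => if hij : i ≠ j then (hE _ _ (hw i j hij)).somePath.extend s else 0) ?_ ?_ ?_ ?_
  · intro i j hij
    simpa [hij] using Path.continuous_extend _
  · intro i j hij
    simp [hij]
  · intro i j hij
    simp [hij]
  · intro i j k l hij hkl hik hil hjk hjl s t
    have hdis := hd _ _ _ _ (hw i j hij) (hw k l hkl) (hne i k hik) (hne i l hil) (hne j k hjk)
      (hne j l hjl)
    simp only [ne_eq, hij, hkl, not_false_eq_true, dite_true]
    exact hdis.ne_of_mem (JoinedIn.somePath_mem _ _) (JoinedIn.somePath_mem _ _)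

open Classical in
/-- Contraction of the edge `uv` into `v`; the vertex `u` stays as an isolated vertex. -/
def contract (G : SimpleGraph V) (u v : V) : SimpleGraph V where
  Adj x y := x ≠ y ∧ ∃ a b, G.Adj a b ∧ (if a = u then v else a) = x ∧ (if b = u then v else b) = y
  symm := ⟨fun _ _ ⟨hne, a, b, hab, ha, hb⟩ => ⟨hne.symm, b, a, hab.symm, hb, ha⟩⟩
  loopless := ⟨fun _ h => h.1 rfl⟩

theorem Adj.contract {G : SimpleGraph V} {u v x y : V} (h : G.Adj x y) (hx : x ≠ u) (hy : y ≠ u) :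
    (G.contract u v).Adj x y :=
  ⟨h.ne, x, y, h, if_neg hx, if_neg hy⟩

theorem Adj.contract_of_left {G : SimpleGraph V} {u v y : V} (h : G.Adj u y) (hy : y ≠ v) :
    (G.contract u v).Adj v y :=
  ⟨hy.symm, u, y, h, if_pos rfl, if_neg h.ne'⟩

open Classical in
theorem IsWeaklyPlanar.contract {G : SimpleGraph V} (h : G.IsWeaklyPlanar) {u v : V}
    (huv : G.Adj u v) : (G.contract u v).IsWeaklyPlanar := by
  obtain ⟨f, E, hE, hd⟩ := h
  let φ : V → V := fun a => if a = u then v else a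
  refine ⟨f, fun x y => {z | ∃ a b, G.Adj a b ∧ (φ a = x ∨ φ a = y) ∧ (φ b = x ∨ φ b = y) ∧
    z ∈ E a b}, ?_, ?_⟩
  · rintro x y ⟨-, a, b, hab, rfl, rfl⟩
    have hsub : ∀ c d, G.Adj c d → (φ c = φ a ∨ φ c = φ b) → (φ d = φ a ∨ φ d = φ b) →
        E c d ⊆ {z | ∃ c d, G.Adj c d ∧ (φ c = φ a ∨ φ c = φ b) ∧ (φ d = φ a ∨ φ d = φ b) ∧
          z ∈ E c d} :=
      fun c d hcd hc hd z hz => ⟨c, d, hcd, hc, hd, hz⟩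
    have hmid := (hE a b hab).mono (hsub a b hab (Or.inl rfl) (Or.inr rfl))
    have hφ : ∀ c, (φ c = φ a ∨ φ c = φ b) →
        f c ∈ {z | ∃ c d, G.Adj c d ∧ (φ c = φ a ∨ φ c = φ b) ∧ (φ d = φ a ∨ φ d = φ b) ∧
          z ∈ E c d} → JoinedIn {z | ∃ c d, G.Adj c d ∧ (φ c = φ a ∨ φ c = φ b) ∧
          (φ d = φ a ∨ φ d = φ b) ∧ z ∈ E c d} (f c) (f (φ c)) := by
      intro c hc hmem
      by_cases hcu : c = u
      · subst hcu
        have h₁ : φ c = v := if_pos rfl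
        have h₂ : φ v = v := if_neg huv.ne'
        rw [h₁] at hc ⊢
        exact (hE _ _ huv).mono (hsub _ _ huv (by rwa [h₁]) (by rwa [h₂]))
      · rw [show φ c = c from if_neg hcu]
        exact JoinedIn.refl hmem
    exact ((hφ a (Or.inl rfl) hmid.source_mem).symm.trans hmid).trans
      (hφ b (Or.inr rfl) hmid.target_mem)
  · intro x y x' y' _ _ hxx hxy hyx hyy
    rw [Set.disjoint_left]
    rintro z ⟨a, b, hab, ha, hb, hz⟩ ⟨c, d, hcd, hc, hd', hz'⟩
    have hne : ∀ p q, (φ p = x ∨ φ p = y) → (φ q = x' ∨ φ q = y') → p ≠ q := by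
      rintro p _ hp hq rfl
      rcases hp with rfl | rfl <;> rcases hq with h | h <;> tauto
    exact Set.disjoint_left.1 (hd a b c d hab hcd (hne _ _ ha hc) (hne _ _ ha hd')
      (hne _ _ hb hc) (hne _ _ hb hd')) hz hz'

open Classical in
/-- The number of ordered pairs of adjacent vertices in `S`. -/
noncomputable def dartsOn (G : SimpleGraph V) (S : Finset V) : ℕ :=
  ∑ x ∈ S, (S.filter (G.Adj x)).card

open Classical in
theorem dartsOn_le_contract (G : SimpleGraph V) {S : Finset V} {u v : V} (hu : u ∈ S) (hv : v ∈ S)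
    (huv : G.Adj u v) :
    G.dartsOn S ≤ (G.contract u v).dartsOn (S.erase u) + 2 +
      2 * (S.filter fun x => G.Adj u x ∧ G.Adj v x).card := by
  set H := G.contract u v
  set T := S.erase u with hT
  have hvT : v ∈ T := Finset.mem_erase.2 ⟨huv.ne', hv⟩
  set c := (S.filter fun x => G.Adj u x ∧ G.Adj v x).card
  have hother : ∀ x ∈ T.erase v, (S.filter (G.Adj x)).card ≤
      (T.filter (H.Adj x)).card + if G.Adj u x ∧ G.Adj v x then 1 else 0 := by
    intro x hx
    simp only [T, Finset.mem_erase] at hx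
    obtain ⟨hxv, hxu, hxS⟩ := hx
    split_ifs with hc
    · calc (S.filter (G.Adj x)).card ≤ (insert u (T.filter (H.Adj x))).card := by
            refine Finset.card_le_card fun y hy => ?_
            rw [Finset.mem_filter] at hy
            by_cases hyu : y = u
            · simp [hyu]
            · exact Finset.mem_insert_of_mem (Finset.mem_filter.2
                ⟨Finset.mem_erase.2 ⟨hyu, hy.1⟩, hy.2.contract hxu hyu⟩)
        _ ≤ _ := Finset.card_insert_le _ _
    · refine Finset.card_le_card_of_injOn (fun y => if y = u then v else y) ?_ ?_
      · intro y hy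
        simp only [Finset.coe_filter, Set.mem_ofPred_eq] at hy ⊢
        by_cases hyu : y = u
        · subst hyu
          rw [if_pos rfl]
          exact ⟨hvT, (hy.2.symm.contract_of_left hxv).symm⟩
        · rw [if_neg hyu]
          exact ⟨Finset.mem_erase.2 ⟨hyu, hy.1⟩, hy.2.contract hxu hyu⟩
      · intro y hy z hz hyz
        simp only [Finset.coe_filter, Set.mem_ofPred_eq] at hy hz
        dsimp only at hyz
        split_ifs at hyz with h₁ h₂ h₂
        · rw [h₁, h₂]
        · subst h₁ hyz; exact absurd ⟨hy.2.symm, hz.2.symm⟩ hc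
        · subst h₂ hyz; exact absurd ⟨hz.2.symm, hy.2.symm⟩ hc
        · exact hyz
  have hmerge : (S.filter (G.Adj u)).card + (S.filter (G.Adj v)).card ≤
      (T.filter (H.Adj v)).card + 2 + c := by
    rw [← Finset.card_union_add_card_inter, ← Finset.filter_and]
    refine Nat.add_le_add_right ?_ _
    calc _ ≤ (insert u (insert v (T.filter (H.Adj v)))).card := by
          refine Finset.card_le_card fun y hy => ?_
          simp only [Finset.mem_union, Finset.mem_filter] at hy
          simp only [Finset.mem_insert, Finset.mem_filter, T, Finset.mem_erase]
          by_cases hyu : y = u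
          · exact Or.inl hyu
          by_cases hyv : y = v
          · exact Or.inr (Or.inl hyv)
          rcases hy with ⟨hyS, hy⟩ | ⟨hyS, hy⟩
          · exact Or.inr (Or.inr ⟨⟨hyu, hyS⟩, hy.contract_of_left hyv⟩)
          · exact Or.inr (Or.inr ⟨⟨hyu, hyS⟩, hy.contract huv.ne' hyu⟩)
      _ ≤ _ := (Finset.card_insert_le _ _).trans (Nat.add_le_add_right (Finset.card_insert_le _ _) 1)
  have hcount : ∑ x ∈ T.erase v, (if G.Adj u x ∧ G.Adj v x then 1 else 0) ≤ c := by
    rw [← Finset.card_filter]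
    exact Finset.card_le_card (Finset.filter_subset_filter _
      ((Finset.erase_subset _ _).trans (Finset.erase_subset _ _)))
  have hsum := Finset.sum_le_sum hother
  rw [Finset.sum_add_distrib] at hsum
  simp only [dartsOn]
  rw [← Finset.add_sum_erase S _ hu, ← hT, ← Finset.add_sum_erase T _ hvT,
    ← Finset.add_sum_erase T (fun x => (T.filter (H.Adj x)).card) hvT]
  omega

open Classical in
/-- The induction step of the edge bound: in a class of graphs and vertex sets closed under
contraction, if neighbourhoods satisfy the bound `k * n - k * (k + 1) / 2` on the number of edges
and `k ≤ 1`, then all sets satisfy the corresponding bound for `k + 1`. -/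
theorem dartsOn_add_le_of_neighbors {k : ℕ} (hk : k ≤ 1) (P : SimpleGraph V → Finset V → Prop)
    (hcontract : ∀ G S u v, P G S → u ∈ S → v ∈ S → G.Adj u v → P (G.contract u v) (S.erase u))
    (hneighbors : ∀ G S v, P G S → v ∈ S → k ≤ (S.filter (G.Adj v)).card →
      G.dartsOn (S.filter (G.Adj v)) + k * (k + 1) ≤ 2 * k * (S.filter (G.Adj v)).card)
    (G : SimpleGraph V) (S : Finset V) (hP : P G S) (hS : k + 1 ≤ S.card) :
    G.dartsOn S + (k + 1) * (k + 2) ≤ 2 * (k + 1) * S.card := by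
  obtain ⟨n, hn⟩ := Nat.exists_eq_add_of_le hS
  induction n generalizing G S with
  | zero =>
    have hdeg : ∀ x ∈ S, (S.filter (G.Adj x)).card ≤ k := by
      intro x hx
      have : S.filter (G.Adj x) ⊆ S.erase x := fun y hy => by
        rw [Finset.mem_filter] at hy
        exact Finset.mem_erase.2 ⟨hy.2.ne', hy.1⟩
      have := Finset.card_le_card this
      rw [Finset.card_erase_of_mem hx] at this
      omega
    have := Finset.sum_le_card_nsmul S _ k hdeg
    rw [hn] at this ⊢
    simp only [dartsOn, smul_eq_mul] at this ⊢
    linarith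
  | succ n ih =>
    by_cases hedge : ∃ u ∈ S, ∃ v ∈ S, G.Adj u v ∧
        (S.filter fun x => G.Adj u x ∧ G.Adj v x).card ≤ k
    · obtain ⟨u, hu, v, hv, huv, hc⟩ := hedge
      have hcard := Finset.card_erase_of_mem hu
      have := ih (G.contract u v) (S.erase u) (hcontract G S u v hP hu hv huv) (by omega)
        (by omega)
      have := dartsOn_le_contract G hu hv huv
      have : (S.erase u).card + 1 = S.card := by omega
      rw [← this]
      linarith
    · push Not at hedge
      have hzero : ∀ v ∈ S, S.filter (G.Adj v) = ∅ := by
        intro v hv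
        by_contra hne
        obtain ⟨w, hw⟩ := Finset.nonempty_iff_ne_empty.2 hne
        have hsub : ∀ x ∈ S.filter (G.Adj v),
            k + 1 ≤ ((S.filter (G.Adj v)).filter (G.Adj x)).card := by
          intro x hx
          rw [Finset.mem_filter] at hx
          have := hedge v hv x hx.1 hx.2
          rwa [Finset.filter_filter]
        have hN : k ≤ (S.filter (G.Adj v)).card :=
          ((Nat.le_succ k).trans (hsub w hw)).trans
            (Finset.card_le_card (Finset.filter_subset _ _))
        have hle := hneighbors G S v hP hv hN
        have hge := Finset.card_nsmul_le_sum _ _ _ hsub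
        have hpos := Finset.card_pos.2 ⟨w, hw⟩
        simp only [dartsOn, smul_eq_mul] at hle hge
        interval_cases k <;> omega
      have : G.dartsOn S = 0 := Finset.sum_eq_zero fun v hv => by rw [hzero v hv]; rfl
      rw [this, hn]
      nlinarith

/-- A weakly planar graph in which the vertices of `A` are adjacent to each other and to all
vertices of `S`. -/
structure IsJoinOn (A : Finset V) (G : SimpleGraph V) (S : Finset V) : Prop where
  isWeaklyPlanar : G.IsWeaklyPlanar
  notMem : ∀ a ∈ A, a ∉ S
  adj : ∀ a ∈ A, ∀ b, b ∈ A ∨ b ∈ S → a ≠ b → G.Adj a b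

open Classical in
theorem IsJoinOn.contract {A : Finset V} {G : SimpleGraph V} {S : Finset V} (h : IsJoinOn A G S)
    {u v : V} (hu : u ∈ S) (huv : G.Adj u v) : IsJoinOn A (G.contract u v) (S.erase u) where
  isWeaklyPlanar := h.isWeaklyPlanar.contract huv
  notMem a ha haS := h.notMem a ha (Finset.mem_of_mem_erase haS)
  adj a ha b hb hab := by
    refine (h.adj a ha b (hb.imp_right Finset.mem_of_mem_erase) hab).contract ?_ ?_
    · rintro rfl; exact h.notMem _ ha hu
    · rintro rfl
      exact hb.elim (fun hb => h.notMem _ hb hu) (fun hb => (Finset.mem_erase.1 hb).1 rfl)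

open Classical in
theorem IsJoinOn.neighbors {A : Finset V} {G : SimpleGraph V} {S : Finset V} (h : IsJoinOn A G S)
    {v : V} (hv : v ∈ S) : IsJoinOn (insert v A) G (S.filter (G.Adj v)) where
  isWeaklyPlanar := h.isWeaklyPlanar
  notMem a ha haS := by
    rw [Finset.mem_filter] at haS
    rcases Finset.mem_insert.1 ha with rfl | ha
    exacts [haS.2.ne rfl, h.notMem a ha haS.1]
  adj a ha b hb hab := by
    rcases Finset.mem_insert.1 ha with rfl | ha
    · rcases hb with hb | hb
      · exact (h.adj b (Finset.mem_of_mem_insert_of_ne hb hab.symm) a (Or.inr hv) hab.symm).symm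
      · exact (Finset.mem_filter.1 hb).2
    · refine h.adj a ha b ?_ hab
      rcases hb with hb | hb
      · exact (Finset.mem_insert.1 hb).elim (fun e => Or.inr (e ▸ hv)) Or.inl
      · exact Or.inr (Finset.mem_filter.1 hb).1

theorem IsJoinOn.dartsOn_eq_zero {A : Finset V} {G : SimpleGraph V} {S : Finset V}
    (h : IsJoinOn A G S) (hA : A.card = 3) : G.dartsOn S = 0 := by
  classical
  refine Finset.sum_eq_zero fun u hu => Finset.card_eq_zero.2 ?_
  refine Finset.filter_eq_empty_iff.2 fun v hv huv => ?_
  obtain ⟨a, b, c, hab, hac, hbc, rfl⟩ := Finset.card_eq_three.1 hA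
  have hadj := h.adj
  have hnot := h.notMem
  have hau : a ≠ u := fun e => hnot a (by simp) (e ▸ hu)
  have hav : a ≠ v := fun e => hnot a (by simp) (e ▸ hv)
  have hbu : b ≠ u := fun e => hnot b (by simp) (e ▸ hu)
  have hbv : b ≠ v := fun e => hnot b (by simp) (e ▸ hv)
  have hcu : c ≠ u := fun e => hnot c (by simp) (e ▸ hu)
  have hcv : c ≠ v := fun e => hnot c (by simp) (e ▸ hv)
  have hlt : ∀ i j : Fin 5, i < j → G.Adj (![a, b, c, u, v] i) (![a, b, c, u, v] j) := by
    intro i j hij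
    fin_cases i <;> fin_cases j <;> first
      | exact absurd hij (by decide)
      | exact huv
      | exact hadj _ (by simp) _ (by simp [hu, hv]) (by assumption)
  exact h.isWeaklyPlanar.not_completeGraph_five ![a, b, c, u, v] fun i j hij =>
    (lt_or_gt_of_ne hij).elim (hlt i j) fun hji => (hlt j i hji).symm

theorem IsJoinOn.dartsOn_add_two_le {A : Finset V} {G : SimpleGraph V} {S : Finset V}
    (h : IsJoinOn A G S) (hA : A.card = 2) (hS : 1 ≤ S.card) : G.dartsOn S + 2 ≤ 2 * S.card := by
  classical
  refine dartsOn_add_le_of_neighbors (k := 0) zero_le_one (IsJoinOn A)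
    (fun G S u v hP hu _ huv => hP.contract hu huv) (fun G S v hP hv _ => ?_) G S h hS
  rw [(hP.neighbors hv).dartsOn_eq_zero
    (by rw [Finset.card_insert_of_notMem fun hvA => hP.notMem v hvA hv, hA])]
  simp

theorem IsJoinOn.dartsOn_add_six_le {A : Finset V} {G : SimpleGraph V} {S : Finset V}
    (h : IsJoinOn A G S) (hA : A.card = 1) (hS : 2 ≤ S.card) : G.dartsOn S + 6 ≤ 4 * S.card := by
  classical
  refine dartsOn_add_le_of_neighbors (k := 1) le_rfl (IsJoinOn A)
    (fun G S u v hP hu _ huv => hP.contract hu huv) (fun G S v hP hv hN => ?_) G S h hS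
  exact (hP.neighbors hv).dartsOn_add_two_le
    (by rw [Finset.card_insert_of_notMem fun hvA => hP.notMem v hvA hv, hA]) hN

theorem cone_adj_some {G : SimpleGraph V} {u v : V} : G.cone.Adj (some u) (some v) ↔ G.Adj u v := by
  simp only [cone, fromRel_adj, ne_eq, Option.some.injEq, reduceCtorEq, or_false]
  constructor
  · rintro ⟨-, ⟨_, _, rfl, rfl, h⟩ | ⟨_, _, rfl, rfl, h⟩⟩
    exacts [h, h.symm]
  · exact fun h => ⟨h.ne, Or.inl ⟨u, v, rfl, rfl, h⟩⟩

theorem cone_adj_none {G : SimpleGraph V} {v : V} : G.cone.Adj none (some v) := by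
  simp [cone]

open Classical in
/-- An outerplanar graph on `n ≥ 2` vertices has at most `2 * n - 3` edges. -/
theorem IsOuterplanar.card_edgeFinset_add_three_le [Fintype V] {G : SimpleGraph V}
    (h : G.IsOuterplanar) (hV : 2 ≤ Fintype.card V) :
    G.edgeFinset.card + 3 ≤ 2 * Fintype.card V := by
  have hjoin : IsJoinOn {none} G.cone (Finset.univ.map Function.Embedding.some) :=
    { isWeaklyPlanar := IsPlanar.isWeaklyPlanar h
      notMem := by simp
      adj := by
        intro a ha b _ hab
        rw [Finset.mem_singleton] at ha
        subst ha
        cases b with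
        | none => exact absurd rfl hab
        | some v => exact cone_adj_none }
  have hle := hjoin.dartsOn_add_six_le (by simp) (by simpa using hV)
  have hdarts : G.cone.dartsOn (Finset.univ.map Function.Embedding.some) = ∑ v, G.degree v := by
    rw [dartsOn, Finset.sum_map]
    refine Finset.sum_congr rfl fun v _ => ?_
    rw [Finset.filter_map, Finset.card_map, ← card_neighborFinset_eq_degree]
    congr 1
    ext w
    simp [cone_adj_some]
  rw [hdarts, sum_degrees_eq_twice_card_edges, Finset.card_map, Finset.card_univ] at hle
  omega

end SimpleGraph

namespace SimpleGraph

variable {V : Type*}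

/-- A straight-line drawing without crossings shows planarity. -/
theorem isPlanar_of_openSegment {G : SimpleGraph V} {f : V → ℝ × ℝ} (hf : Function.Injective f)
    (hv : ∀ u v w, G.Adj u v → f w ∉ openSegment ℝ (f u) (f v))
    (he : ∀ u v x y, G.Adj u v → G.Adj x y → ∀ z, z ∈ openSegment ℝ (f u) (f v) →
      z ∈ openSegment ℝ (f x) (f y) → s(u, v) = s(x, y)) : G.IsPlanar := by
  have hmem : ∀ u v (t : unitInterval), t ≠ 0 → t ≠ 1 →
      Path.segment (f u) (f v) t ∈ openSegment ℝ (f u) (f v) := by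
    intro u v t h₀ h₁
    rw [openSegment_eq_image_lineMap]
    exact ⟨t, ⟨unitInterval.pos_iff_ne_zero.2 h₀, unitInterval.lt_one_iff_ne_one.2 h₁⟩, rfl⟩
  refine ⟨f, hf, fun u v _ => Path.segment (f u) (f v), ?_, ?_, ?_⟩
  · exact fun u v h => Path.segment_injective_of_ne (hf.ne h.ne)
  · intro u v h t h₀ h₁ w hw
    exact hv u v w h (hw ▸ hmem u v t h₀ h₁)
  · intro u v x y h h' hne s t h₀ h₁ hst
    by_cases ht₀ : t = 0
    · subst ht₀
      exact hv u v x h (by simpa [hst] using hmem u v s h₀ h₁)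
    by_cases ht₁ : t = 1
    · subst ht₁
      exact hv u v y h (by simpa [hst] using hmem u v s h₀ h₁)
    exact hne (he u v x y h h' _ (hmem u v s h₀ h₁) (hst ▸ hmem x y t ht₀ ht₁))

theorem exists_of_mem_openSegment_parabola {a b : ℝ} {z : ℝ × ℝ}
    (hz : z ∈ openSegment ℝ (a, a ^ 2) (b, b ^ 2)) (hab : a ≠ b) :
    z.2 - z.1 ^ 2 = (z.1 - a) * (b - z.1) ∧ 0 < z.2 - z.1 ^ 2 := by
  obtain ⟨s, t, hs, ht, hst, rfl⟩ := hz
  obtain rfl : s = 1 - t := by linarith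
  have hpos : 0 < (1 - t) * t * (b - a) ^ 2 := by
    have := sq_pos_of_ne_zero (sub_ne_zero.2 hab.symm)
    positivity
  constructor
  · simp; ring
  · simp only [Prod.smul_mk, smul_eq_mul, Prod.mk_add_mk]
    nlinarith

theorem eq_of_chords_meet {a b c d x : ℝ} (hab : a < b) (hcd : c < d)
    (h : (x - a) * (b - x) = (x - c) * (d - x)) (hpos : 0 < (x - a) * (b - x))
    (h₁ : ¬(a < c ∧ c < b ∧ b < d)) (h₂ : ¬(c < a ∧ a < d ∧ d < b)) : a = c ∧ b = d := by
  have hbetween : ∀ {p q : ℝ}, p < q → 0 < (x - p) * (q - x) → p < x ∧ x < q := by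
    intro p q hpq hp
    rcases pos_and_pos_or_neg_and_neg_of_mul_pos hp with h | h
    · constructor <;> linarith
    · linarith
  obtain ⟨hax, hxb⟩ := hbetween hab hpos
  obtain ⟨hcx, hxd⟩ := hbetween hcd (h ▸ hpos)
  rcases lt_trichotomy a c with hac | rfl | hac
  · refine absurd ⟨hac, hcx.trans hxb, ?_⟩ h₁
    by_contra! hdb
    nlinarith
  · refine ⟨rfl, ?_⟩
    have := mul_left_cancel₀ (sub_pos.2 hax).ne' h
    linarith
  · refine absurd ⟨hac, hax.trans hxd, ?_⟩ h₂
    by_contra! hbd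
    nlinarith

/-- A graph whose vertices are placed on a line such that no two edges drawn on one side of the
line cross is outerplanar. -/
theorem isOuterplanar_of_noncrossing [Finite V] {G : SimpleGraph V} {pos : V → ℝ}
    (hpos : Function.Injective pos)
    (hG : ∀ a b c d, G.Adj a b → G.Adj c d → pos a < pos c → pos c < pos b → pos b < pos d →
      False) : G.IsOuterplanar := by
  obtain ⟨M, hM⟩ : ∃ M : ℝ, ∀ v, pos v ^ 2 < M := by
    obtain ⟨B, hB⟩ := (Set.finite_range fun v => pos v ^ 2).bddAbove
    exact ⟨B + 1, fun v => lt_add_of_le_of_pos (hB ⟨v, rfl⟩) one_pos⟩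
  let f : Option V → ℝ × ℝ := fun o => o.elim (0, -M) fun v => (pos v, pos v ^ 2)
  have chord : ∀ u v z, G.Adj u v → z ∈ openSegment ℝ (f (some u)) (f (some v)) →
      z.2 - z.1 ^ 2 = (z.1 - pos u) * (pos v - z.1) ∧ 0 < z.2 - z.1 ^ 2 := fun u v z h hz =>
    exists_of_mem_openSegment_parabola hz (hpos.ne h.ne)
  have spoke : ∀ v z, z ∈ openSegment ℝ (f none) (f (some v)) →
      (∃ s, 0 < s ∧ z = (s * pos v, -M + s * (pos v ^ 2 + M))) ∧ z.2 - z.1 ^ 2 < 0 := by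
    rintro v z ⟨r, s, hr, hs, hrs, rfl⟩
    obtain rfl : r = 1 - s := by linarith
    refine ⟨⟨s, hs, ?_⟩, ?_⟩
    · simp [f]; ring
    · have h₁ : s * pos v ^ 2 < M := by nlinarith [hM v, sq_nonneg (pos v)]
      simp only [f, Option.elim, Prod.smul_mk, smul_eq_mul, Prod.mk_add_mk]
      nlinarith [mul_pos hr (sub_pos.2 h₁)]
  have chord_chord : ∀ a b c d z, G.Adj a b → G.Adj c d →
      z ∈ openSegment ℝ (f (some a)) (f (some b)) → z ∈ openSegment ℝ (f (some c)) (f (some d)) →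
      s(some a, some b) = s(some c, some d) := by
    intro a b c d z hab hcd hz hz'
    wlog hlt : pos a < pos b generalizing a b
    · rw [Sym2.eq_swap]
      exact this b a hab.symm (by rwa [openSegment_symm])
        ((hpos.ne hab.ne').lt_of_le (not_lt.1 hlt))
    wlog hlt' : pos c < pos d generalizing c d
    · rw [Sym2.eq_swap (a := some c)]
      exact this d c hcd.symm (by rwa [openSegment_symm])
        ((hpos.ne hcd.ne').lt_of_le (not_lt.1 hlt'))
    obtain ⟨h₁, h₂⟩ := chord a b z hab hz
    obtain ⟨h₃, -⟩ := chord c d z hcd hz'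
    obtain ⟨hac, hbd⟩ := eq_of_chords_meet hlt hlt' (h₁.symm.trans h₃) (h₁ ▸ h₂)
      (fun h => hG a b c d hab hcd h.1 h.2.1 h.2.2) (fun h => hG c d a b hcd hab h.1 h.2.1 h.2.2)
    rw [hpos hac, hpos hbd]
  have spoke_spoke : ∀ a b z, z ∈ openSegment ℝ (f none) (f (some a)) →
      z ∈ openSegment ℝ (f none) (f (some b)) → a = b := by
    intro a b z hz hz'
    obtain ⟨⟨s, hs, rfl⟩, -⟩ := spoke a z hz
    obtain ⟨⟨s', hs', h⟩, -⟩ := spoke b _ hz'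
    rw [Prod.mk.injEq] at h
    obtain ⟨h₁, h₂⟩ := h
    have h₃ : (s * s') * ((pos a - pos b) * (M - pos a * pos b)) = 0 := by
      linear_combination (s' * pos b ^ 2 + s' * M) * h₁ - s' * pos b * h₂
    have h₄ : M - pos a * pos b ≠ 0 := by nlinarith [hM a, hM b, sq_nonneg (pos a - pos b)]
    have h₅ := (mul_eq_zero.1 h₃).resolve_left (mul_pos hs hs').ne'
    exact hpos (sub_eq_zero.1 ((mul_eq_zero.1 h₅).resolve_right h₄))
  refine isPlanar_of_openSegment (f := f) ?_ ?_ ?_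
  · rintro (_ | a) (_ | b) h
    · rfl
    · have := congrArg Prod.snd h
      simp only [f, Option.elim] at this
      nlinarith [hM b, sq_nonneg (pos b)]
    · have := congrArg Prod.snd h
      simp only [f, Option.elim] at this
      nlinarith [hM a, sq_nonneg (pos a)]
    · exact congrArg some (hpos (congrArg Prod.fst h))
  · have hspoke : ∀ v w, f w ∉ openSegment ℝ (f none) (f (some v)) := by
      rintro v (_ | w) hw
      · obtain ⟨⟨s, hs, h⟩, -⟩ := spoke v _ hw
        have := congrArg Prod.snd h
        simp only [f, Option.elim] at this
        have : 0 < s * (pos v ^ 2 + M) :=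
          mul_pos hs (by nlinarith [hM v, sq_nonneg (pos v)])
        linarith
      · simpa [f] using (spoke v _ hw).2
    rintro (_ | u) (_ | v) w h hw
    · exact h.ne rfl
    · exact hspoke v w hw
    · exact hspoke u w (by rwa [openSegment_symm])
    · have := (chord u v _ (cone_adj_some.1 h) hw).2
      cases w with
      | none =>
        simp only [f, Option.elim] at this
        nlinarith [hM u, sq_nonneg (pos u)]
      | some w => simp [f] at this
  · have normal : ∀ u v z, G.cone.Adj u v → z ∈ openSegment ℝ (f u) (f v) →
        (∃ a b, s(u, v) = s(some a, some b) ∧ G.Adj a b ∧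
          z ∈ openSegment ℝ (f (some a)) (f (some b))) ∨
        ∃ a, s(u, v) = s(none, some a) ∧ z ∈ openSegment ℝ (f none) (f (some a)) := by
      rintro (_ | u) (_ | v) z h hz
      · exact absurd rfl h.ne
      · exact Or.inr ⟨v, rfl, hz⟩
      · exact Or.inr ⟨u, Sym2.eq_swap, by rwa [openSegment_symm]⟩
      · exact Or.inl ⟨u, v, rfl, cone_adj_some.1 h, hz⟩
    intro u v x y h h' z hz hz'
    rcases normal u v z h hz with ⟨a, b, e, hab, hz⟩ | ⟨a, e, hz⟩ <;>
      rcases normal x y z h' hz' with ⟨c, d, e', hcd, hz'⟩ | ⟨c, e', hz'⟩ <;> rw [e, e']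
    · exact chord_chord a b c d z hab hcd hz hz'
    · exact absurd (chord a b z hab hz).2 (spoke c z hz').2.not_gt
    · exact absurd (chord c d z hcd hz').2 (spoke a z hz).2.not_gt
    · rw [spoke_spoke a c z hz hz']

/-- The pairs `a < b` adjacent in a maximal set of chords of a `4 * t`-gon: consecutive corners,
and the last corner of each of the four blocks of `t` corners with all corners of the next
block. -/
def IsChord (t a b : ℕ) : Prop :=
  b = a + 1 ∨ (a + 1 = t ∧ b < 2 * t) ∨ (a + 1 = 2 * t ∧ b < 3 * t) ∨ a + 1 = 3 * t ∨
    (b + 1 = 4 * t ∧ a < t)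

/-- The graph in which vertices are adjacent if their positions are joined by a chord. -/
def chordGraph (t : ℕ) (pos : V → ℕ) : SimpleGraph V :=
  fromRel fun u v => pos u < pos v ∧ IsChord t (pos u) (pos v)

theorem chordGraph_adj {t : ℕ} {pos : V → ℕ} {u v : V} :
    (chordGraph t pos).Adj u v ↔ (pos u < pos v ∧ IsChord t (pos u) (pos v)) ∨
      (pos v < pos u ∧ IsChord t (pos v) (pos u)) := by
  rw [chordGraph, fromRel_adj]
  exact and_iff_right_of_imp fun h e => by subst e; rcases h with h | h <;> exact lt_irrefl _ h.1

theorem isOuterplanar_chordGraph [Finite V] {t : ℕ} {pos : V → ℕ} (hinj : Function.Injective pos)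
    (hlt : ∀ v, pos v < 4 * t) : (chordGraph t pos).IsOuterplanar := by
  refine isOuterplanar_of_noncrossing (pos := fun v => (pos v : ℝ))
    (Nat.cast_injective.comp hinj) fun a b c d hab hcd h₁ h₂ h₃ => ?_
  rw [Nat.cast_lt] at h₁ h₂ h₃
  rw [chordGraph_adj] at hab hcd
  obtain ⟨-, hab⟩ := hab.resolve_right fun h => (h₁.trans h₂).not_gt h.1
  obtain ⟨-, hcd⟩ := hcd.resolve_right fun h => (h₂.trans h₃).not_gt h.1
  have := hlt d
  unfold IsChord at hab hcd
  omega

/-- The rank of `k` in the zigzag order `m, m + 1, m - 1, m + 2, m - 2, …, m + t` of the integers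
modulo `2 * t`, where `k, m < 2 * t`. -/
def zigzagRank (t k m : ℕ) : ℕ :=
  if m < k then (if k ≤ m + t then 2 * (k - m) - 1 else 2 * (m + 2 * t - k))
  else (if m < k + t then 2 * (m - k) else 2 * (k + 2 * t - m) - 1)

/-- The position on the polygon of the vertices of `K_{4t}` in the `i`-th outerplanar graph: the
two halves of the vertices are arranged in opposite zigzag orders. -/
def zigzagPos (t i v : ℕ) : ℕ :=
  if v < 2 * t then
    (if zigzagRank t v i < t then 4 * t - 1 - zigzagRank t v i else zigzagRank t v i)
  else
    (if zigzagRank t i (v - 2 * t) < t then t - 1 - zigzagRank t i (v - 2 * t)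
      else t + zigzagRank t i (v - 2 * t))

/-- Positions in which the vertices `k` and `k + t` of each half are consecutive. -/
def antipodalPos (t v : ℕ) : ℕ :=
  if v < t then 2 * v else if v < 2 * t then 2 * (v - t) + 1
  else if v < 3 * t then 2 * (v - t) else 2 * (v - 2 * t) + 1

theorem antipodalPos_add {t v : ℕ} (hv : v < t ∨ 2 * t ≤ v ∧ v < 3 * t) :
    antipodalPos t (v + t) = antipodalPos t v + 1 := by
  unfold antipodalPos; split_ifs <;> omega

theorem zigzagRank_lt {t k m : ℕ} (hk : k < 2 * t) : zigzagRank t k m < 2 * t := by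
  unfold zigzagRank; split_ifs <;> omega

theorem zigzagRank_inj_left {t k l m : ℕ} (hk : k < 2 * t) (hl : l < 2 * t) (hm : m < 2 * t)
    (h : zigzagRank t k m = zigzagRank t l m) : k = l := by
  unfold zigzagRank at h; split_ifs at h <;> omega

theorem zigzagRank_inj_right {t k l m : ℕ} (hk : k < 2 * t) (hl : l < 2 * t) (hm : m < 2 * t)
    (h : zigzagRank t m k = zigzagRank t m l) : k = l := by
  unfold zigzagRank at h; split_ifs at h <;> omega

theorem zigzagRank_self {t m : ℕ} (hm : m < 2 * t) : zigzagRank t m m = 0 := by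
  unfold zigzagRank; split_ifs <;> omega

theorem zigzagRank_add_left {t k m : ℕ} (hk : k < 2 * t) (hm : m < t) :
    zigzagRank t k m + zigzagRank t k (m + t) + 1 = 2 * t := by
  unfold zigzagRank; split_ifs <;> omega

theorem zigzagRank_add_right {t k m : ℕ} (hk : k < t) (hm : m < 2 * t) :
    zigzagRank t k m + zigzagRank t (k + t) m + 1 = 2 * t := by
  unfold zigzagRank; split_ifs <;> omega

theorem exists_zigzagRank_left {t k l : ℕ} (hk : k < 2 * t) (hl : l < 2 * t) (hkl : k ≠ l) :
    ∃ i < t, (zigzagRank t k i + 1 = zigzagRank t l i ∨ zigzagRank t l i + 1 = zigzagRank t k i) ∧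
      ((zigzagRank t k i < t ↔ zigzagRank t l i < t) ∨ k + t = l ∨ l + t = k) := by
  wlog hlt : k < l generalizing k l
  · obtain ⟨i, hi, h₁, h₂⟩ := this hl hk hkl.symm (by omega)
    exact ⟨i, hi, h₁.symm, h₂.imp Iff.symm Or.symm⟩
  refine ⟨if k + l < 2 * t then (k + l) / 2 else (k + l - 2 * t) / 2, ?_, ?_, ?_⟩
  · split_ifs <;> omega
  · unfold zigzagRank; split_ifs <;> omega
  · unfold zigzagRank; split_ifs <;> omega

theorem exists_zigzagRank_right {t k l : ℕ} (hk : k < 2 * t) (hl : l < 2 * t) (hkl : k ≠ l) :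
    ∃ i < t, (zigzagRank t i k + 1 = zigzagRank t i l ∨ zigzagRank t i l + 1 = zigzagRank t i k) ∧
      ((zigzagRank t i k < t ↔ zigzagRank t i l < t) ∨ k + t = l ∨ l + t = k) := by
  wlog hlt : k < l generalizing k l
  · obtain ⟨i, hi, h₁, h₂⟩ := this hl hk hkl.symm (by omega)
    exact ⟨i, hi, h₁.symm, h₂.imp Iff.symm Or.symm⟩
  refine ⟨if k + l + 1 < 2 * t then (k + l + 1) / 2 else (k + l + 1 - 2 * t) / 2, ?_, ?_, ?_⟩
  · split_ifs <;> omega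
  · unfold zigzagRank; split_ifs <;> omega
  · unfold zigzagRank; split_ifs <;> omega

theorem zigzagPos_lt {t i : ℕ} (hi : i < t) (v : ℕ) : zigzagPos t i v < 4 * t := by
  unfold zigzagPos
  split_ifs with h
  · omega
  · have := zigzagRank_lt (t := t) (k := v) (m := i) (by omega); omega
  · omega
  · have := zigzagRank_lt (t := t) (k := i) (m := v - 2 * t) (by omega); omega

theorem zigzagPos_inj {t i v w : ℕ} (hi : i < t) (hv : v < 4 * t) (hw : w < 4 * t)
    (h : zigzagPos t i v = zigzagPos t i w) : v = w := by
  have rank_lt : ∀ {k} m, k < 2 * t → zigzagRank t k m < 2 * t := fun _ => zigzagRank_lt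
  unfold zigzagPos at h
  by_cases hv₂ : v < 2 * t <;> by_cases hw₂ : w < 2 * t
  · have := rank_lt i hv₂
    have := rank_lt i hw₂
    refine zigzagRank_inj_left hv₂ hw₂ (m := i) (by omega) ?_
    split_ifs at h <;> omega
  · have := rank_lt i hv₂
    have := rank_lt (k := i) (w - 2 * t) (by omega)
    split_ifs at h <;> omega
  · have := rank_lt (k := i) (v - 2 * t) (by omega)
    have := rank_lt i hw₂
    split_ifs at h <;> omega
  · have := rank_lt (k := i) (v - 2 * t) (by omega)
    have := rank_lt (k := i) (w - 2 * t) (by omega)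
    have := zigzagRank_inj_right (t := t) (k := v - 2 * t) (l := w - 2 * t) (m := i) (by omega)
      (by omega) (by omega) (by split_ifs at h <;> omega)
    omega

/-- The zigzag graphs and the antipodal matching cover all pairs of vertices. -/
theorem exists_chordGraph_adj {t v w : ℕ} (hv : v < 4 * t) (hw : w < 4 * t) (hvw : v ≠ w) :
    (∃ i < t, (chordGraph t (zigzagPos t i)).Adj v w) ∨
      (chordGraph t (antipodalPos t)).Adj v w := by
  wlog hlt : v < w generalizing v w
  · exact (this hw hv hvw.symm (by omega)).imp (fun ⟨i, hi, h⟩ => ⟨i, hi, h.symm⟩) Adj.symm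
  simp only [chordGraph_adj, IsChord]
  by_cases hw₂ : w < 2 * t
  · have hv₂ := hlt.trans hw₂
    obtain ⟨i, hi, h₁, h₂⟩ := exists_zigzagRank_left hv₂ hw₂ hvw
    rcases h₂ with h₂ | h₂
    · refine Or.inl ⟨i, hi, ?_⟩
      have : ∀ u, u < 2 * t → zigzagPos t i u =
          if zigzagRank t u i < t then 4 * t - 1 - zigzagRank t u i else zigzagRank t u i :=
        fun u hu => if_pos hu
      rw [this v hv₂, this w hw₂]
      by_cases h : zigzagRank t v i < t
      · rw [if_pos h, if_pos (h₂.1 h)]; omega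
      · rw [if_neg h, if_neg fun h' => h (h₂.2 h')]; omega
    · have := antipodalPos_add (t := t) (v := v) (by omega)
      obtain rfl : w = v + t := by omega
      omega
  by_cases hv₂ : v < 2 * t
  · left
    obtain ⟨l, rfl⟩ : ∃ l, w = l + 2 * t := ⟨w - 2 * t, by omega⟩
    have hl : l < 2 * t := by omega
    simp only [zigzagPos, if_pos hv₂, if_neg hw₂, Nat.add_sub_cancel]
    by_cases h : zigzagRank t v l < t
    · by_cases hvt : v < t
      · refine ⟨v, hvt, ?_⟩
        rw [zigzagRank_self hv₂, if_pos h]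
        split_ifs <;> omega
      · obtain ⟨k, rfl⟩ : ∃ k, v = k + t := ⟨v - t, by omega⟩
        have hk : k < t := by omega
        have h₁ := zigzagRank_add_right hk hl
        have h₂ := zigzagRank_add_right hk (m := k) (by omega)
        rw [zigzagRank_self (by omega)] at h₂
        refine ⟨k, hk, ?_⟩
        split_ifs <;> omega
    · by_cases hlt' : l < t
      · refine ⟨l, hlt', ?_⟩
        rw [zigzagRank_self hl, if_neg h]
        have := zigzagRank_lt (m := l) hv₂
        split_ifs <;> omega
      · obtain ⟨m, rfl⟩ : ∃ m, l = m + t := ⟨l - t, by omega⟩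
        have hm : m < t := by omega
        have h₁ := zigzagRank_add_left hv₂ hm
        have h₂ := zigzagRank_add_left (k := m) (by omega) hm
        rw [zigzagRank_self (by omega)] at h₂
        refine ⟨m, hm, ?_⟩
        split_ifs <;> omega
  · obtain ⟨i, hi, h₁, h₂⟩ := exists_zigzagRank_right (t := t) (k := v - 2 * t) (l := w - 2 * t)
      (by omega) (by omega) (by omega)
    rcases h₂ with h₂ | h₂
    · refine Or.inl ⟨i, hi, ?_⟩
      have : ∀ u, ¬u < 2 * t → zigzagPos t i u =
          if zigzagRank t i (u - 2 * t) < t then t - 1 - zigzagRank t i (u - 2 * t)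
            else t + zigzagRank t i (u - 2 * t) :=
        fun u hu => if_neg hu
      rw [this v hv₂, this w hw₂]
      by_cases h : zigzagRank t i (v - 2 * t) < t
      · rw [if_pos h, if_pos (h₂.1 h)]; omega
      · rw [if_neg h, if_neg fun h' => h (h₂.2 h')]; omega
    · have := antipodalPos_add (t := t) (v := v) (by omega)
      obtain rfl : w = v + t := by omega
      omega

theorem exists_outerplanar_cover_completeGraph_four_mul (t : ℕ) :
    ∃ f : Fin (t + 1) → SimpleGraph (Fin (4 * t)),
      (∀ i, (f i).IsOuterplanar) ∧ (⨆ i, f i) = ⊤ := by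
  refine ⟨fun i => chordGraph t fun v : Fin (4 * t) =>
    if (i : ℕ) < t then zigzagPos t i v else antipodalPos t v, fun i => ?_, ?_⟩
  · by_cases hi : (i : ℕ) < t <;> simp only [hi, if_true, if_false]
    · exact isOuterplanar_chordGraph (fun v w h => Fin.ext (zigzagPos_inj hi v.2 w.2 h))
        fun v => zigzagPos_lt hi v
    · refine isOuterplanar_chordGraph (fun v w h => Fin.ext ?_) fun v => ?_
      · have := v.2
        have := w.2
        dsimp only [antipodalPos] at h
        split_ifs at h <;> omega
      · have := v.2
        dsimp only [antipodalPos]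
        split_ifs <;> omega
  · ext v w
    rw [iSup_adj, top_adj]
    refine ⟨fun ⟨i, hi⟩ => hi.ne, fun hvw => ?_⟩
    rcases exists_chordGraph_adj v.2 w.2 (Fin.val_ne_of_ne hvw) with ⟨i, hi, h⟩ | h
    · refine ⟨⟨i, hi.trans t.lt_succ_self⟩, ?_⟩
      rw [chordGraph_adj] at h ⊢
      simpa only [hi, if_true] using h
    · refine ⟨Fin.last t, ?_⟩
      rw [chordGraph_adj] at h ⊢
      simpa only [Fin.val_last, lt_irrefl, if_false] using h

theorem lt_of_outerplanar_cover_completeGraph_four_mul {t k : ℕ} (ht : 1 ≤ t)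
    {f : Fin k → SimpleGraph (Fin (4 * t))} (hf : ∀ i, (f i).IsOuterplanar)
    (hcover : (⨆ i, f i) = ⊤) : t < k := by
  classical
  have hedges : ∀ i, (f i).edgeFinset.card ≤ 8 * t - 3 := by
    intro i
    have := (hf i).card_edgeFinset_add_three_le (by rw [Fintype.card_fin]; omega)
    rw [Fintype.card_fin] at this
    omega
  have hsub : (⊤ : SimpleGraph (Fin (4 * t))).edgeFinset ⊆
      Finset.univ.biUnion fun i => (f i).edgeFinset := by
    intro e he
    induction e with
    | _ v w =>
      rw [mem_edgeFinset, mem_edgeSet, ← hcover, iSup_adj] at he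
      simpa using he
  have hle := (Finset.card_le_card hsub).trans
    (Finset.card_biUnion_le_card_mul _ _ _ fun i _ => hedges i)
  rw [card_edgeFinset_top_eq_card_choose_two, Fintype.card_fin, Finset.card_univ,
    Fintype.card_fin, Nat.choose_two_right,
    show 4 * t * (4 * t - 1) = 2 * t * (4 * t - 1) * 2 by ring,
    Nat.mul_div_cancel _ two_pos] at hle
  by_contra! hkt
  have := hle.trans (Nat.mul_le_mul_right _ hkt)
  obtain ⟨s, rfl⟩ := Nat.exists_eq_add_of_le' ht
  rw [show 4 * (s + 1) - 1 = 4 * s + 3 by omega, show 8 * (s + 1) - 3 = 8 * s + 5 by omega] at this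
  nlinarith

end SimpleGraph

/-- For every `t ≥ 1`, the outerthickness of `K_{4t}` equals `t + 1`. -/
theorem outerthickness_completeGraph_four_mul (t : ℕ) (ht : 1 ≤ t) :
    (⊤ : SimpleGraph (Fin (4 * t))).outerthickness = t + 1 := by
  have hmem : t + 1 ∈ {k | ∃ f : Fin k → SimpleGraph (Fin (4 * t)),
      (∀ i, (f i).IsOuterplanar) ∧ (⨆ i, f i) = ⊤} :=
    exists_outerplanar_cover_completeGraph_four_mul t
  refine le_antisymm (Nat.sInf_le hmem) ?_
  obtain ⟨f, hf, hcover⟩ := Nat.sInf_mem (Set.nonempty_of_mem hmem)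
  exact lt_of_outerplanar_cover_completeGraph_four_mul ht hf hcover
end

section
/- For every integer t ≥ 1, the 4-girth-thickness of the complete graph K_{4t} equals t+1. -/
open SimpleGraph

section

open Complex Metric Set

/-- `f` has a continuous logarithm on `K`. -/
def HasLogOn (f : ℂ → ℂ) (K : Set ℂ) : Prop :=
  ∃ g : ℂ → ℂ, ContinuousOn g K ∧ ∀ z ∈ K, f z = exp (g z)

namespace HasLogOn

variable {f g : ℂ → ℂ} {K L : Set ℂ}

theorem mono (h : HasLogOn f L) (hKL : K ⊆ L) : HasLogOn f K := by
  obtain ⟨u, hu, hfu⟩ := h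
  exact ⟨u, hu.mono hKL, fun z hz => hfu z (hKL hz)⟩

theorem congr (h : HasLogOn f K) (hfg : ∀ z ∈ K, g z = f z) : HasLogOn g K := by
  obtain ⟨u, hu, hfu⟩ := h
  exact ⟨u, hu, fun z hz => (hfg z hz).trans (hfu z hz)⟩

theorem mul (hf : HasLogOn f K) (hg : HasLogOn g K) : HasLogOn (fun z => f z * g z) K := by
  obtain ⟨u, hu, hfu⟩ := hf
  obtain ⟨v, hv, hgv⟩ := hg
  exact ⟨fun z => u z + v z, hu.add hv, fun z hz => by simp only [exp_add, hfu z hz, hgv z hz]⟩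

theorem zpow (hf : HasLogOn f K) (k : ℤ) : HasLogOn (fun z => f z ^ k) K := by
  obtain ⟨u, hu, hfu⟩ := hf
  exact ⟨fun z => k * u z, hu.const_smul (k : ℂ), fun z hz => by
    simp only [exp_int_mul, hfu z hz]⟩

theorem inv (hf : HasLogOn f K) : HasLogOn (fun z => (f z)⁻¹) K := by
  simpa using hf.zpow (-1)

end HasLogOn

theorem hasLogOn_const {c : ℂ} (hc : c ≠ 0) (K : Set ℂ) : HasLogOn (fun _ => c) K :=
  ⟨fun _ => log c, continuousOn_const, fun _ _ => (exp_log hc).symm⟩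

theorem hasLogOn_of_norm_sub_one_lt {f : ℂ → ℂ} {K : Set ℂ} (hf : ContinuousOn f K)
    (h : ∀ z ∈ K, ‖f z - 1‖ < 1) : HasLogOn f K := by
  have hs : ∀ z ∈ K, f z ∈ slitPlane := fun z hz =>
    ball_one_subset_slitPlane (by simpa [dist_eq_norm] using h z hz)
  exact ⟨fun z => log (f z), hf.clog hs, fun z hz => (exp_log (slitPlane_ne_zero (hs z hz))).symm⟩

theorem exists_continuous_log {X : Type*} [TopologicalSpace X] [SimplyConnectedSpace X]
    [LocallyPathConnectedSpace X] {f : X → ℂ} (hf : Continuous f) (h0 : ∀ x, f x ≠ 0) :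
    ∃ g : X → ℂ, Continuous g ∧ ∀ x, f x = exp (g x) := by
  obtain ⟨x₀⟩ : Nonempty X := inferInstance
  obtain ⟨F, ⟨-, hF⟩, -⟩ := isCoveringMapOn_exp.existsUnique_continuousMap_lifts
    (⟨f, hf⟩ : C(X, ℂ)) (a₀ := x₀) (e₀ := log (f x₀)) (exp_log (h0 x₀)) h0
  exact ⟨F, F.continuous, fun x => (congrFun hF x).symm⟩

open scoped Classical in
theorem hasLogOn_range_of_injective {γ : unitInterval → ℂ} (hγ : Continuous γ)
    (hinj : Function.Injective γ) {f : ℂ → ℂ} (hf : ContinuousOn f (range γ))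
    (h0 : ∀ z ∈ range γ, f z ≠ 0) : HasLogOn f (range γ) := by
  obtain ⟨g, hg, hfg⟩ := exists_continuous_log
    (f := fun t : ℝ => f (γ (projIcc 0 1 zero_le_one t)))
    (hf.comp_continuous (hγ.comp continuous_projIcc) fun t => mem_range_self _)
    fun t => h0 _ (mem_range_self _)
  let e := (hγ.isClosedEmbedding hinj).isEmbedding.toHomeomorph
  refine ⟨fun z => if h : z ∈ range γ then g (e.symm ⟨z, h⟩ : unitInterval) else 0, ?_, ?_⟩
  · rw [continuousOn_iff_continuous_domRestrict]
    have : (range γ).domRestrict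
        (fun z => if h : z ∈ range γ then g (e.symm ⟨z, h⟩ : unitInterval) else 0)
        = fun z => g (e.symm z : unitInterval) := by
      ext z
      exact dif_pos z.2
    rw [this]
    fun_prop
  · rintro _ ⟨t, rfl⟩
    have : e.symm ⟨γ t, mem_range_self t⟩ = t := e.symm_apply_apply t
    simp [this, ← hfg]

theorem IsPreconnected.sub_eq_sub_of_exp_eq {X : Type*} [TopologicalSpace X] {N : Set X}
    (hN : IsPreconnected N) {u v : X → ℂ} (hu : ContinuousOn u N) (hv : ContinuousOn v N)
    (h : ∀ z ∈ N, exp (u z) = exp (v z)) {x y : X} (hx : x ∈ N) (hy : y ∈ N) :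
    u x - v x = u y - v y := by
  have hd : ContinuousOn (fun z => (u z - v z) / (2 * Real.pi * I)) N :=
    (hu.sub hv).div_const _
  have hpi : (2 * Real.pi * I : ℂ) ≠ 0 := by simp [Real.pi_ne_zero]
  have hnint : ∀ z ∈ N, ∃ n : ℤ, (u z - v z) / (2 * Real.pi * I) = n := by
    intro z hz
    obtain ⟨n, hn⟩ := exp_eq_exp_iff_exists_int.1 (h z hz)
    exact ⟨n, by rw [hn]; field_simp; ring⟩
  have hre : ContinuousOn (fun z => ((u z - v z) / (2 * Real.pi * I)).re) N :=
    continuous_re.comp_continuousOn hd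
  have hrnd : ContinuousOn (fun z => round ((u z - v z) / (2 * Real.pi * I)).re) N := by
    intro z hz
    obtain ⟨n, hn⟩ := hnint z hz
    have h1 : ∀ᶠ w in nhdsWithin z N,
        ‖((u w - v w) / (2 * Real.pi * I)).re - ((u z - v z) / (2 * Real.pi * I)).re‖ < 1 := by
      have := Metric.tendsto_nhds.1 (hre z hz) 1 one_pos
      simpa [dist_eq_norm] using this
    refine tendsto_nhds_of_eventually_eq ?_
    filter_upwards [h1, self_mem_nhdsWithin] with w hw hwN
    obtain ⟨m, hm⟩ := hnint w hwN
    simp only [hn, hm, intCast_re, round_intCast] at hw ⊢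
    rw [Real.norm_eq_abs] at hw
    have : |m - n| < 1 := by exact_mod_cast hw
    have := Int.abs_lt_one_iff.1 this
    omega
  have hc := hN.constant hrnd hx hy
  obtain ⟨n, hn⟩ := hnint x hx
  obtain ⟨m, hm⟩ := hnint y hy
  simp only [hn, hm, intCast_re, round_intCast] at hc
  subst hc
  rw [← hm] at hn
  field_simp at hn
  exact hn

theorem eq_zero_of_hasLogOn_sphere {p : ℂ} {r : ℝ} (hr : 0 < r) {k : ℤ}
    (h : HasLogOn (fun z => (z - p) ^ k) (sphere p r)) : k = 0 := by
  obtain ⟨g, hg, hfg⟩ := h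
  have hmem : ∀ θ : ℝ, p + r * exp (θ * I) ∈ sphere p r := fun θ => by
    simp [norm_exp_ofReal_mul_I, abs_of_pos hr]
  have hr' : (r : ℂ) ≠ 0 := by exact_mod_cast hr.ne'
  have key := (isPreconnected_univ (α := ℝ)).sub_eq_sub_of_exp_eq
    (u := fun θ => g (p + r * exp (θ * I))) (v := fun θ => k * (log r + θ * I))
    ((hg.comp_continuous (by fun_prop) hmem).continuousOn) (by fun_prop)
    (fun θ _ => by
      rw [← hfg _ (hmem θ), exp_int_mul, exp_add, exp_log hr']
      simp) (mem_univ 0) (mem_univ (2 * Real.pi))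
  have hpi : (2 * Real.pi * I : ℂ) ≠ 0 := by simp [Real.pi_ne_zero]
  have h2 : exp (((2 * Real.pi : ℝ) : ℂ) * I) = 1 := by
    push_cast
    exact exp_two_pi_mul_I
  simp only [h2, ofReal_zero, zero_mul, exp_zero] at key
  push_cast at key
  have : (k : ℂ) * (2 * Real.pi * I) = 0 := by linear_combination key
  exact_mod_cast (mul_eq_zero.1 this).resolve_right hpi

theorem hasLogOn_sub_div_sub {K M : Set ℂ} (hK : IsPreconnected K) (hM : IsCompact M)
    (hd : Disjoint K M) {p q : ℂ} (hp : p ∈ K) (hq : q ∈ K) :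
    HasLogOn (fun z => (z - p) / (z - q)) M := by
  have hne : ∀ x ∈ K, ∀ z ∈ M, z - x ≠ 0 := fun x hx z hz h =>
    hd.ne_of_mem hx hz (sub_eq_zero.1 h).symm
  refine hK.induction₂ (fun p q => HasLogOn (fun z => (z - p) / (z - q)) M) ?_ ?_ ?_ hp hq
  · intro x hx
    have hxM : x ∉ M := fun h => hd.ne_of_mem hx h rfl
    obtain ⟨ε, hε, hball⟩ := Metric.isOpen_iff.1 hM.isClosed.isOpen_compl x hxM
    have h1 : ∀ᶠ y in nhdsWithin x K, Dist.dist y x < ε / 2 :=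
      nhdsWithin_le_nhds (Metric.ball_mem_nhds x (half_pos hε))
    filter_upwards [h1, self_mem_nhdsWithin] with y hy hyK
    refine hasLogOn_of_norm_sub_one_lt ?_ ?_
    · exact ContinuousOn.div (by fun_prop) (by fun_prop) fun z hz => hne y hyK z hz
    · intro z hz
      have hz0 := hne y hyK z hz
      have h2 : ε ≤ Dist.dist z x := by
        by_contra! hlt
        exact hball hlt hz
      have h3 : (z - x) / (z - y) - 1 = (y - x) / (z - y) := by
        field_simp
        ring
      rw [h3, norm_div, div_lt_one (norm_pos_iff.2 hz0), ← dist_eq_norm, ← dist_eq_norm]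
      have := dist_triangle z y x
      linarith
  · intro x y w hx hy hw hxy hyw
    refine (hxy.mul hyw).congr fun z hz => ?_
    have := hne y hy z hz
    have := hne w hw z hz
    field_simp
  · intro x y hx hy hxy
    refine hxy.inv.congr fun z hz => ?_
    simp

theorem HasLogOn.union_of_eqOn {f u v : ℂ → ℂ} {K L : Set ℂ} (hK : IsClosed K) (hL : IsClosed L)
    (hu : ContinuousOn u K) (hv : ContinuousOn v L) (hfu : ∀ z ∈ K, f z = exp (u z))
    (hfv : ∀ z ∈ L, f z = exp (v z)) (huv : ∀ z ∈ K ∩ L, u z = v z) : HasLogOn f (K ∪ L) := by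
  classical
  refine ⟨K.piecewise u v, ContinuousOn.union_of_isClosed ?_ ?_ hK hL, ?_⟩
  · exact hu.congr fun z hz => by simp [hz]
  · refine hv.congr fun z hz => ?_
    by_cases hzK : z ∈ K
    · simp [hzK, huv z ⟨hzK, hz⟩]
    · simp [hzK]
  · rintro z (hz | hz)
    · simp [hz, hfu z hz]
    · by_cases hzK : z ∈ K
      · simp [hzK, hfu z hzK]
      · simp [hzK, hfv z hz]

theorem IsOpen.exists_isCompact_isPreconnected_superset {W M : Set ℂ} (hW : IsOpen W)
    (hWc : IsPreconnected W) (hM : IsCompact M) (hMW : M ⊆ W) :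
    ∃ N, IsCompact N ∧ IsPreconnected N ∧ M ⊆ N ∧ N ⊆ W := by
  rcases W.eq_empty_or_nonempty with rfl | ⟨x₀, hx₀⟩
  · exact ⟨∅, isCompact_empty, isPreconnected_empty, hMW, Subset.rfl⟩
  have hpath : IsPathConnected W := hW.isConnected_iff_isPathConnected.1 ⟨⟨x₀, hx₀⟩, hWc⟩
  suffices ∃ N, IsCompact N ∧ IsPreconnected N ∧ M ⊆ N ∧ N ⊆ W ∧ x₀ ∈ N by
    obtain ⟨N, h1, h2, h3, h4, -⟩ := this
    exact ⟨N, h1, h2, h3, h4⟩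
  refine hM.induction_on
    (p := fun M => ∃ N, IsCompact N ∧ IsPreconnected N ∧ M ⊆ N ∧ N ⊆ W ∧ x₀ ∈ N) ?_ ?_ ?_ ?_
  · exact ⟨{x₀}, isCompact_singleton, isPreconnected_singleton, empty_subset _, by simpa, by simp⟩
  · rintro s t hst ⟨N, h1, h2, h3, h4⟩
    exact ⟨N, h1, h2, hst.trans h3, h4⟩
  · rintro s t ⟨N, h1, h2, h3, h4, h5⟩ ⟨N', h1', h2', h3', h4', h5'⟩
    exact ⟨N ∪ N', h1.union h1', h2.union x₀ h5 h5' h2', union_subset_union h3 h3',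
      union_subset h4 h4', .inl h5⟩
  · intro x hx
    obtain ⟨ε, hε, hball⟩ := Metric.nhds_basis_closedBall.mem_iff.1 (hW.mem_nhds (hMW hx))
    obtain ⟨γ, hγ⟩ := hpath.joinedIn x₀ hx₀ x (hMW hx)
    refine ⟨closedBall x ε, nhdsWithin_le_nhds (closedBall_mem_nhds x hε),
      range γ ∪ closedBall x ε, (isCompact_range γ.continuous).union (isCompact_closedBall x ε),
      (isPreconnected_range γ.continuous).union x ⟨1, γ.target⟩ (mem_closedBall_self hε.le)
        isPreconnected_closedBall, subset_union_right,
      union_subset (range_subset_iff.2 hγ) hball, .inl ⟨0, γ.source⟩⟩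

theorem not_isPreconnected_diff_of_isCompact {U A K : Set ℂ} (hU : IsOpen U) (hA : IsCompact A)
    (hAc : IsPreconnected A) (hK : IsPreconnected K) (hKU : Disjoint K U) {p q : ℂ} (hpq : p ≠ q)
    (hpK : p ∈ K) (hqK : q ∈ K) (hpA : p ∈ A) (hqA : q ∈ A) (hAU : A ⊆ U ∪ {p, q}) :
    ¬ IsPreconnected (U \ A) := by
  intro hconn
  have hr : 0 < Dist.dist p q / 2 := half_pos (dist_pos.2 hpq)
  have hcover : sphere p (Dist.dist p q / 2) ⊆ U ∪ Aᶜ := by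
    intro z hz
    rw [mem_sphere] at hz
    by_cases hzA : z ∈ A
    · rcases hAU hzA with h | rfl | rfl
      · exact .inl h
      · simp only [_root_.dist_self] at hz
        linarith
      · rw [_root_.dist_comm] at hz
        linarith
    · exact .inr hzA
  obtain ⟨M₁, M₂, hM₁, hM₂, hMU, hMA, hM⟩ :=
    (isCompact_sphere p (Dist.dist p q / 2)).binary_compact_cover hU hA.isClosed.isOpen_compl hcover
  obtain ⟨N, hN, hNc, hMN, hNW⟩ :=
    (hU.sdiff hA.isClosed).exists_isCompact_isPreconnected_superset hconn (hM₁.inter hM₂)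
      (fun z hz => ⟨hMU hz.1, hMA hz.2⟩)
  have hdisj₁ : Disjoint K (M₁ ∪ N) :=
    hKU.mono_right (union_subset hMU (hNW.trans sdiff_subset))
  have hdisj₂ : Disjoint A (M₂ ∪ N) :=
    disjoint_compl_right.mono_right (union_subset hMA fun z hz => (hNW hz).2)
  obtain ⟨g₁, hg₁, hfg₁⟩ := hasLogOn_sub_div_sub hK (hM₁.union hN) hdisj₁ hpK hqK
  obtain ⟨g₂, hg₂, hfg₂⟩ := hasLogOn_sub_div_sub hAc (hM₂.union hN) hdisj₂ hpA hqA
  obtain ⟨c, hc, hcN⟩ : ∃ c, exp c = 1 ∧ ∀ z ∈ N, g₁ z = g₂ z + c := by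
    have hexp : ∀ z ∈ N, exp (g₁ z) = exp (g₂ z) := fun z hz => by
      rw [← hfg₁ z (.inr hz), ← hfg₂ z (.inr hz)]
    rcases N.eq_empty_or_nonempty with rfl | ⟨w, hw⟩
    · exact ⟨0, exp_zero, by simp⟩
    · refine ⟨g₁ w - g₂ w, by rw [exp_sub, hexp w hw, div_self (exp_ne_zero _)], fun z hz => ?_⟩
      have := hNc.sub_eq_sub_of_exp_eq (hg₁.mono subset_union_right)
        (hg₂.mono subset_union_right) hexp hz hw
      linear_combination this
  have hlog := HasLogOn.union_of_eqOn (f := fun z => (z - p) / (z - q)) (hM₁.union hN).isClosed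
    (hM₂.union hN).isClosed hg₁ (hg₂.add (continuousOn_const (c := c))) hfg₁
    (fun z hz => by
      simp only [Pi.add_apply]
      rw [exp_add, hc, mul_one]
      exact hfg₂ z hz)
    (by
      rintro z ⟨h1 | h1, h2 | h2⟩
      · exact hcN z (hMN ⟨h1, h2⟩)
      all_goals exact hcN z (by assumption))
  have hlog' : HasLogOn (fun z => (z - p) / (z - q)) (sphere p (Dist.dist p q / 2)) := by
    refine hlog.mono ?_
    rw [hM]
    exact union_subset_union subset_union_left subset_union_left
  have hpq0 : p - q ≠ 0 := sub_ne_zero.2 hpq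
  have hlogq : HasLogOn (fun z => (z - q) / (p - q)) (sphere p (Dist.dist p q / 2)) := by
    refine hasLogOn_of_norm_sub_one_lt (by fun_prop) fun z hz => ?_
    have h3 : (z - q) / (p - q) - 1 = (z - p) / (p - q) := by
      field_simp
      ring
    rw [h3, norm_div, div_lt_one (norm_pos_iff.2 hpq0), ← dist_eq_norm, ← dist_eq_norm,
      mem_sphere.1 hz]
    linarith
  have := ((hlog'.mul hlogq).mul (hasLogOn_const hpq0 _)).congr (g := fun z => (z - p) ^ (1 : ℤ))
    fun z hz => by
      have : z - q ≠ 0 := by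
        intro h
        rw [sub_eq_zero.1 h, mem_sphere, _root_.dist_comm] at hz
        linarith
      field_simp
  exact one_ne_zero (eq_zero_of_hasLogOn_sphere hr this)

theorem eq_zero_of_hasLogOn_of_frontier_subset {K U : Set ℂ} (hK : IsCompact K)
    (hUb : Bornology.IsBounded U) (hU : IsOpen U) (hfr : frontier U ⊆ K) {a b c : ℂ} (ha : a ∈ U)
    (hb : b ∉ closure U) (hc : c ∉ closure U) {k l m : ℤ}
    (h : HasLogOn (fun z => (z - a) ^ k * (z - b) ^ l * (z - c) ^ m) K) : k = 0 := by
  classical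
  obtain ⟨g, hg, hfg⟩ := h
  obtain ⟨G, hG⟩ := ContinuousMap.exists_restrict_eq hK.isClosed
    (⟨K.domRestrict g, hg.domRestrict⟩ : C(K, ℂ))
  have hG' : ∀ z ∈ K, G z = g z := fun z hz => DFunLike.congr_fun hG ⟨z, hz⟩
  have hne : ∀ {x y : ℂ} {s : Set ℂ}, x ∉ s → y ∈ s → y - x ≠ 0 := fun hx hy h =>
    hx (sub_eq_zero.1 h ▸ hy)
  let r : ℂ → ℂ := (closure U).piecewise
    (fun z => exp (G z) * (z - b) ^ (-l) * (z - c) ^ (-m)) fun z => (z - a) ^ k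
  have hr₁ : ∀ z ∈ closure U, r z = exp (G z) * (z - b) ^ (-l) * (z - c) ^ (-m) :=
    fun z hz => piecewise_eq_of_mem _ _ _ hz
  have hr₂ : ∀ z ∈ Uᶜ, r z = (z - a) ^ k := by
    intro z hz
    by_cases hzU : z ∈ closure U
    · have hzK : z ∈ K := hfr ⟨hzU, by rwa [hU.interior_eq]⟩
      rw [hr₁ z hzU, hG' z hzK, ← hfg z hzK]
      have := hne hb hzU
      have := hne hc hzU
      simp only [zpow_neg]
      field_simp
    · exact piecewise_eq_of_notMem _ _ _ hzU
  have hcont : Continuous r := by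
    have h1 : ContinuousOn r (closure U) := by
      refine ContinuousOn.congr (ContinuousOn.mul (ContinuousOn.mul (by fun_prop) ?_) ?_) hr₁
      · exact ContinuousOn.zpow₀ (by fun_prop) _ fun z hz => .inl (hne hb hz)
      · exact ContinuousOn.zpow₀ (by fun_prop) _ fun z hz => .inl (hne hc hz)
    have h2 : ContinuousOn r Uᶜ := by
      refine ContinuousOn.congr ?_ hr₂
      exact ContinuousOn.zpow₀ (by fun_prop) _ fun z hz =>
        .inl fun h => hz (sub_eq_zero.1 h ▸ ha)
    have h3 := h1.union_of_isClosed h2 isClosed_closure hU.isClosed_compl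
    rwa [univ_subset_iff.1 ((union_compl_self U).symm.subset.trans
      (union_subset_union_left _ subset_closure)), continuousOn_univ] at h3
  have hr0 : ∀ z, r z ≠ 0 := by
    intro z
    by_cases hz : z ∈ U
    · rw [hr₁ z (subset_closure hz)]
      have hz' := subset_closure hz
      exact mul_ne_zero (mul_ne_zero (exp_ne_zero _) (zpow_ne_zero _ (hne hb hz')))
        (zpow_ne_zero _ (hne hc hz'))
    · rw [hr₂ z hz]
      exact zpow_ne_zero _ fun h => hz (sub_eq_zero.1 h ▸ ha)
  obtain ⟨u, hu, hru⟩ := exists_continuous_log hcont hr0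
  obtain ⟨R, hR, hUR⟩ := hUb.subset_ball_lt 0 a
  refine eq_zero_of_hasLogOn_sphere (p := a) hR ⟨u, hu.continuousOn, fun z hz => ?_⟩
  rw [← hru, hr₂ z fun hzU => (mem_ball.1 (hUR hzU)).ne (mem_sphere.1 hz)]

theorem IsClosed.frontier_connectedComponentIn_compl_subset {K : Set ℂ} (hK : IsClosed K) (a : ℂ) :
    frontier (connectedComponentIn Kᶜ a) ⊆ K := by
  intro z hz
  by_contra hzK
  have hopen : ∀ x, IsOpen (connectedComponentIn Kᶜ x) := fun x => hK.isOpen_compl.connectedComponentIn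
  obtain ⟨w, hwz, hwa⟩ := mem_closure_iff.1 hz.1 _ (hopen z) (mem_connectedComponentIn hzK)
  refine hz.2 ?_
  rw [(hopen a).interior_eq]
  rw [connectedComponentIn_eq hwa, ← connectedComponentIn_eq hwz]
  exact mem_connectedComponentIn hzK

theorem eq_zero_of_hasLogOn_of_isBounded {K : Set ℂ} (hK : IsCompact K) {a b c : ℂ}
    (ha : a ∉ K) (hb : b ∉ K) (hc : c ∉ K)
    (hab : connectedComponentIn Kᶜ a ≠ connectedComponentIn Kᶜ b)
    (hac : connectedComponentIn Kᶜ a ≠ connectedComponentIn Kᶜ c)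
    (hbdd : Bornology.IsBounded (connectedComponentIn Kᶜ a)) {k l m : ℤ}
    (h : HasLogOn (fun z => (z - a) ^ k * (z - b) ^ l * (z - c) ^ m) K) : k = 0 := by
  have hfr := hK.isClosed.frontier_connectedComponentIn_compl_subset a
  have hopen : IsOpen (connectedComponentIn Kᶜ a) := hK.isClosed.isOpen_compl.connectedComponentIn
  have key : ∀ x ∉ K, connectedComponentIn Kᶜ a ≠ connectedComponentIn Kᶜ x →
      x ∉ closure (connectedComponentIn Kᶜ a) := by
    intro x hx hax hcl
    by_cases hxa : x ∈ connectedComponentIn Kᶜ a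
    · exact hax (connectedComponentIn_eq hxa)
    · exact hx (hfr ⟨hcl, by rwa [hopen.interior_eq]⟩)
  exact eq_zero_of_hasLogOn_of_frontier_subset hK hbdd hopen hfr (mem_connectedComponentIn ha)
    (key b hb hab) (key c hc hac) h

theorem isPreconnected_setOf_lt_norm {R : ℝ} (hR : 0 < R) : IsPreconnected {z : ℂ | R < ‖z‖} := by
  have h : {z : ℂ | R < ‖z‖} = exp '' {w | Real.log R < w.re} := by
    ext z
    constructor
    · intro hz
      have hz0 : 0 < ‖z‖ := hR.trans hz
      exact ⟨log z, by simpa [log_re] using Real.log_lt_log hR hz, exp_log (norm_pos_iff.1 hz0)⟩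
    · rintro ⟨w, hw, rfl⟩
      simpa [norm_exp] using (Real.log_lt_iff_lt_exp hR).1 hw
  rw [h]
  exact (convex_halfSpace_re_gt _).isPreconnected.image _ continuous_exp.continuousOn

theorem connectedComponentIn_eq_of_not_isBounded {K : Set ℂ} (hK : Bornology.IsBounded K) {a b : ℂ}
    (ha : ¬ Bornology.IsBounded (connectedComponentIn Kᶜ a))
    (hb : ¬ Bornology.IsBounded (connectedComponentIn Kᶜ b)) :
    connectedComponentIn Kᶜ a = connectedComponentIn Kᶜ b := by
  obtain ⟨R, hR, hKR⟩ := hK.subset_closedBall_lt 0 0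
  have hE : {z : ℂ | R < ‖z‖} ⊆ Kᶜ := fun z hz hzK => by
    have := hKR hzK
    simp only [mem_closedBall, dist_zero_right] at this
    exact absurd hz (not_lt.2 this)
  have key : ∀ {x : ℂ}, ¬ Bornology.IsBounded (connectedComponentIn Kᶜ x) →
      ∃ y ∈ connectedComponentIn Kᶜ x, R < ‖y‖ := by
    intro x hx
    by_contra! h
    exact hx ((isBounded_closedBall (x := (0 : ℂ)) (r := R)).subset fun y hy => by simpa using h y hy)
  obtain ⟨x, hxa, hx⟩ := key ha
  obtain ⟨y, hyb, hy⟩ := key hb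
  rw [connectedComponentIn_eq hxa, connectedComponentIn_eq hyb]
  exact connectedComponentIn_eq
    ((isPreconnected_setOf_lt_norm hR).subset_connectedComponentIn hx hE hy)

theorem connectedComponentIn_eq_of_hasLogOn {K : Set ℂ} (hK : IsCompact K) {a b : ℂ}
    (ha : a ∉ K) (hb : b ∉ K) (h : HasLogOn (fun z => (z - a) / (z - b)) K) :
    connectedComponentIn Kᶜ a = connectedComponentIn Kᶜ b := by
  by_contra hab
  by_cases hbdd : Bornology.IsBounded (connectedComponentIn Kᶜ a)
  · exact one_ne_zero (eq_zero_of_hasLogOn_of_isBounded hK ha hb hb hab hab hbdd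
      (k := 1) (l := -1) (m := 0) (h.congr fun z _ => by simp [div_eq_mul_inv]))
  by_cases hbdd' : Bornology.IsBounded (connectedComponentIn Kᶜ b)
  · exact one_ne_zero (eq_zero_of_hasLogOn_of_isBounded hK hb ha ha (Ne.symm hab) (Ne.symm hab) hbdd'
      (k := 1) (l := -1) (m := 0) (h.inv.congr fun z _ => by simp [div_eq_mul_inv]))
  exact hab (connectedComponentIn_eq_of_not_isBounded hK.isBounded hbdd hbdd')

theorem exists_connectedComponentIn_eq_of_isPreconnected {K P : Set ℂ} (hK : IsCompact K)
    {γ : unitInterval → ℂ} (hγ : Continuous γ) (hinj : Function.Injective γ) (h0 : γ 0 ∈ K)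
    (h1 : γ 1 ∈ K) (hKγ : K ∩ range γ ⊆ {γ 0, γ 1}) (hP : IsPreconnected P) (hPK : P ⊆ Kᶜ)
    {a b c : ℂ} (ha : a ∈ P \ range γ) (hb : b ∈ P \ range γ) (hc : c ∈ P \ range γ) :
    connectedComponentIn (K ∪ range γ)ᶜ a = connectedComponentIn (K ∪ range γ)ᶜ b ∨
    connectedComponentIn (K ∪ range γ)ᶜ a = connectedComponentIn (K ∪ range γ)ᶜ c ∨
    connectedComponentIn (K ∪ range γ)ᶜ b = connectedComponentIn (K ∪ range γ)ᶜ c := by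
  set X := K ∪ range γ with hX
  have hXc : IsCompact X := hK.union (isCompact_range hγ)
  have hnot : ∀ {x}, x ∈ P \ range γ → x ∉ X := fun hx h => h.elim (hPK hx.1) hx.2
  have hpi : (2 * Real.pi * I : ℂ) ≠ 0 := by simp [Real.pi_ne_zero]
  have key : ∀ {x y}, x ∈ P \ range γ → y ∈ P \ range γ → ∃ (u v : ℂ → ℂ) (n : ℤ),
      ContinuousOn u K ∧ ContinuousOn v (range γ) ∧ (∀ z ∈ K, (z - x) / (z - y) = exp (u z)) ∧
      (∀ z ∈ range γ, (z - x) / (z - y) = exp (v z)) ∧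
      u (γ 0) - v (γ 0) - (u (γ 1) - v (γ 1)) = n * (2 * Real.pi * I) := by
    intro x y hx hy
    obtain ⟨u, hu, hfu⟩ := hasLogOn_sub_div_sub hP hK (subset_compl_iff_disjoint_right.1 hPK) hx.1 hy.1
    have hne : ∀ {x}, x ∈ P \ range γ → ∀ z ∈ range γ, z - x ≠ 0 := fun hx z hz h =>
      hx.2 (sub_eq_zero.1 h ▸ hz)
    obtain ⟨v, hv, hfv⟩ := hasLogOn_range_of_injective hγ hinj (f := fun z => (z - x) / (z - y))
      (ContinuousOn.div (by fun_prop) (by fun_prop) (hne hy))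
      (fun z hz => div_ne_zero (hne hx z hz) (hne hy z hz))
    have hnint : ∀ t, γ t ∈ K → ∃ n : ℤ, u (γ t) = v (γ t) + n * (2 * Real.pi * I) := fun t ht =>
      exp_eq_exp_iff_exists_int.1 (by rw [← hfu _ ht, hfv _ (mem_range_self t)])
    obtain ⟨n, hn⟩ := hnint 0 h0
    obtain ⟨m, hm⟩ := hnint 1 h1
    exact ⟨u, v, n - m, hu, hv, hfu, hfv, by rw [hn, hm]; push_cast; ring⟩
  obtain ⟨u₁, v₁, n₁, hu₁, hv₁, hfu₁, hfv₁, hn₁⟩ := key ha hb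
  obtain ⟨u₂, v₂, n₂, hu₂, hv₂, hfu₂, hfv₂, hn₂⟩ := key hb hc
  have hglue : ∀ (k l : ℤ), k * n₁ + l * n₂ = 0 →
      HasLogOn (fun z => ((z - a) / (z - b)) ^ k * ((z - b) / (z - c)) ^ l) X := by
    intro k l hkl
    have hkl' : (k : ℂ) * n₁ + l * n₂ = 0 := by exact_mod_cast hkl
    set d := k * (u₁ (γ 0) - v₁ (γ 0)) + l * (u₂ (γ 0) - v₂ (γ 0)) with hd
    have hd1 : exp d = 1 := by
      rw [hd, exp_add, exp_int_mul, exp_int_mul, exp_sub, exp_sub, ← hfu₁ _ h0, ← hfu₂ _ h0,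
        ← hfv₁ _ (mem_range_self 0), ← hfv₂ _ (mem_range_self 0), div_self, div_self]
      · simp
      · rw [hfv₂ _ (mem_range_self 0)]
        exact exp_ne_zero _
      · rw [hfv₁ _ (mem_range_self 0)]
        exact exp_ne_zero _
    refine HasLogOn.union_of_eqOn (u := fun z => k * u₁ z + l * u₂ z)
      (v := fun z => k * v₁ z + l * v₂ z + d) hK.isClosed (isCompact_range hγ).isClosed
      (by fun_prop) (by fun_prop) ?_ ?_ ?_
    · intro z hz
      rw [exp_add, exp_int_mul, exp_int_mul, hfu₁ z hz, hfu₂ z hz]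
    · intro z hz
      rw [exp_add, hd1, mul_one, exp_add, exp_int_mul, exp_int_mul, hfv₁ z hz, hfv₂ z hz]
    · intro z hz
      rcases hKγ hz with rfl | rfl
      · rw [hd]
        ring
      · rw [hd]
        linear_combination (-k : ℂ) * hn₁ - l * hn₂ - (2 * Real.pi * I) * hkl'
  by_contra! hcon
  obtain ⟨hab, hac, hbc⟩ := hcon
  have hn0 : n₁ ≠ 0 := fun h => hab <| connectedComponentIn_eq_of_hasLogOn hXc (hnot ha) (hnot hb)
    ((hglue 1 0 (by simp [h])).congr fun z _ => by simp)
  have hlog : HasLogOn (fun z => (z - a) ^ n₂ * (z - b) ^ (-n₁ - n₂) * (z - c) ^ n₁) X := by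
    refine (hglue n₂ (-n₁) (by ring)).congr fun z hz => ?_
    have hne : ∀ {x}, x ∈ P \ range γ → z - x ≠ 0 := fun hx h => hnot hx (sub_eq_zero.1 h ▸ hz)
    have := hne ha
    have := hne hb
    have := hne hc
    rw [zpow_sub₀ (hne hb), div_zpow, div_zpow]
    simp only [zpow_neg]
    field_simp
  have hA : Bornology.IsBounded (connectedComponentIn Xᶜ a) → n₂ = 0 := fun h =>
    eq_zero_of_hasLogOn_of_isBounded hXc (hnot ha) (hnot hb) (hnot hc) hab hac h hlog
  have hB : Bornology.IsBounded (connectedComponentIn Xᶜ b) → -n₁ - n₂ = 0 := fun h =>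
    eq_zero_of_hasLogOn_of_isBounded hXc (hnot hb) (hnot ha) (hnot hc) hab.symm hbc h
      (hlog.congr fun z _ => by ring)
  have hC : Bornology.IsBounded (connectedComponentIn Xᶜ c) → n₁ = 0 := fun h =>
    eq_zero_of_hasLogOn_of_isBounded hXc (hnot hc) (hnot ha) (hnot hb) hac.symm hbc.symm h
      (hlog.congr fun z _ => by ring)
  have hCu : ¬ Bornology.IsBounded (connectedComponentIn Xᶜ c) := fun h => hn0 (hC h)
  have hAb : Bornology.IsBounded (connectedComponentIn Xᶜ a) := by
    by_contra h
    exact hac (connectedComponentIn_eq_of_not_isBounded hXc.isBounded h hCu)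
  have hBb : Bornology.IsBounded (connectedComponentIn Xᶜ b) := by
    by_contra h
    exact hbc (connectedComponentIn_eq_of_not_isBounded hXc.isBounded h hCu)
  have := hA hAb
  have := hB hBb
  omega

variable {V : Type*}

/-- The arcs `γ e`, for `e ∈ E`, draw the graph with edge set `E` in the plane, with vertices placed
by `φ`. -/
structure IsDrawing (φ : V → ℂ) (γ : Sym2 V → unitInterval → ℂ) (E : Finset (Sym2 V)) : Prop where
  injective_vertex : Function.Injective φ
  continuous : ∀ e ∈ E, Continuous (γ e)
  injective : ∀ e ∈ E, Function.Injective (γ e)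
  exists_ends : ∀ e ∈ E, ∃ a b, e = s(a, b) ∧ γ e 0 = φ a ∧ γ e 1 = φ b
  ne_vertex : ∀ e ∈ E, ∀ t ∈ Ioo (0 : unitInterval) 1, ∀ v, γ e t ≠ φ v
  ne_arc : ∀ e ∈ E, ∀ e' ∈ E, e ≠ e' → ∀ t ∈ Ioo (0 : unitInterval) 1, ∀ s, γ e t ≠ γ e' s

/-- The part of a drawing formed by the vertices in `C` and the arcs of the edges in `S`. -/
def drawnSet (φ : V → ℂ) (γ : Sym2 V → unitInterval → ℂ) (C : Set V) (S : Finset (Sym2 V)) : Set ℂ :=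
  φ '' C ∪ ⋃ e ∈ S, range (γ e)

section drawnSet

variable {φ : V → ℂ} {γ : Sym2 V → unitInterval → ℂ} {C D : Set V} {S T : Finset (Sym2 V)}

theorem vertex_mem_drawnSet {v : V} (hv : v ∈ C) : φ v ∈ drawnSet φ γ C S :=
  .inl (mem_image_of_mem φ hv)

theorem arc_mem_drawnSet {e : Sym2 V} (he : e ∈ S) (t : unitInterval) : γ e t ∈ drawnSet φ γ C S :=
  .inr (mem_biUnion he (mem_range_self t))

theorem drawnSet_mono (hCD : C ⊆ D) (hST : S ⊆ T) : drawnSet φ γ C S ⊆ drawnSet φ γ D T :=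
  union_subset_union (image_mono hCD) (biUnion_subset_biUnion_left hST)

theorem drawnSet_insert [DecidableEq V] (e : Sym2 V) :
    drawnSet φ γ C (insert e S) = drawnSet φ γ C S ∪ range (γ e) := by
  simp only [drawnSet, Finset.mem_insert, iUnion_iUnion_eq_or_left]
  ac_rfl

end drawnSet

namespace IsDrawing

variable {φ : V → ℂ} {γ : Sym2 V → unitInterval → ℂ} {E S T : Finset (Sym2 V)} {C : Set V}

theorem mono (h : IsDrawing φ γ E) (hS : S ⊆ E) : IsDrawing φ γ S where
  injective_vertex := h.injective_vertex
  continuous e he := h.continuous e (hS he)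
  injective e he := h.injective e (hS he)
  exists_ends e he := h.exists_ends e (hS he)
  ne_vertex e he := h.ne_vertex e (hS he)
  ne_arc e he e' he' := h.ne_arc e (hS he) e' (hS he')

theorem mem_of_arc_eq_vertex (h : IsDrawing φ γ E) {e : Sym2 V} (he : e ∈ E) {t : unitInterval}
    {v : V} (hv : γ e t = φ v) : v ∈ e := by
  obtain ⟨a, b, rfl, ha, hb⟩ := h.exists_ends e he
  by_cases h0 : t = 0
  · subst h0
    simp [h.injective_vertex (hv.symm.trans ha)]
  by_cases h1 : t = 1
  · subst h1
    simp [h.injective_vertex (hv.symm.trans hb)]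
  exact absurd hv (h.ne_vertex _ he t ⟨unitInterval.pos_iff_ne_zero.2 h0,
    unitInterval.lt_one_iff_ne_one.2 h1⟩ v)

theorem exists_vertex_of_arc_eq_arc (h : IsDrawing φ γ E) {e e' : Sym2 V} (he : e ∈ E) (he' : e' ∈ E)
    (hne : e ≠ e') {t s : unitInterval} (hts : γ e t = γ e' s) :
    ∃ v, v ∈ e ∧ v ∈ e' ∧ γ e t = φ v := by
  obtain ⟨a, b, hab, ha, hb⟩ := h.exists_ends e he
  have key : ∀ v, γ e t = φ v → ∃ v, v ∈ e ∧ v ∈ e' ∧ γ e t = φ v := fun v hv =>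
    ⟨v, h.mem_of_arc_eq_vertex he hv, h.mem_of_arc_eq_vertex he' (hts.symm.trans hv), hv⟩
  by_cases h0 : t = 0
  · exact key a (h0 ▸ ha)
  by_cases h1 : t = 1
  · exact key b (h1 ▸ hb)
  exact absurd hts (h.ne_arc _ he _ he' hne t ⟨unitInterval.pos_iff_ne_zero.2 h0,
    unitInterval.lt_one_iff_ne_one.2 h1⟩ s)

theorem mem_of_vertex_mem_drawnSet (h : IsDrawing φ γ E) (hS : S ⊆ E) {v : V}
    (hv : φ v ∈ drawnSet φ γ C S) : v ∈ C ∨ ∃ e ∈ S, v ∈ e := by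
  rcases hv with ⟨w, hw, hwv⟩ | hv
  · exact .inl (h.injective_vertex hwv ▸ hw)
  · obtain ⟨e, he, t, ht⟩ := mem_iUnion₂.1 hv
    exact .inr ⟨e, he, h.mem_of_arc_eq_vertex (hS he) ht⟩

theorem isCompact_drawnSet [Finite V] (h : IsDrawing φ γ E) (hS : S ⊆ E) :
    IsCompact (drawnSet φ γ C S) :=
  ((C.toFinite.image φ).isCompact).union
    (S.isCompact_biUnion fun e he => isCompact_range (h.continuous e (hS he)))

theorem exists_vertex_of_mem_drawnSet_of_arc_eq (h : IsDrawing φ γ E) (hS : S ⊆ E) {e : Sym2 V}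
    (he : e ∈ E) (heS : e ∉ S) {t : unitInterval} (ht : γ e t ∈ drawnSet φ γ C S) :
    ∃ v ∈ e, γ e t = φ v := by
  rcases ht with ⟨w, hw, hwv⟩ | hv
  · exact ⟨w, h.mem_of_arc_eq_vertex he hwv.symm, hwv.symm⟩
  · obtain ⟨e', he', s, hs⟩ := mem_iUnion₂.1 hv
    obtain ⟨v, hv, -, hv'⟩ := h.exists_vertex_of_arc_eq_arc he (hS he')
      (fun hee => heS (hee ▸ he')) hs.symm
    exact ⟨v, hv, hv'⟩

theorem disjoint_arc_interior_drawnSet (h : IsDrawing φ γ E) (hS : S ⊆ E) {e : Sym2 V}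
    (he : e ∈ E) (heS : e ∉ S) : γ e '' Ioo 0 1 ⊆ (drawnSet φ γ C S)ᶜ := by
  rintro _ ⟨t, ht, rfl⟩ hmem
  obtain ⟨v, -, hv⟩ := h.exists_vertex_of_mem_drawnSet_of_arc_eq hS he heS hmem
  exact h.ne_vertex e he t ht v hv

theorem drawnSet_inter_range_subset (h : IsDrawing φ γ E) (hS : S ⊆ E) {e : Sym2 V}
    (he : e ∈ E) (heS : e ∉ S) : drawnSet φ γ C S ∩ range (γ e) ⊆ {γ e 0, γ e 1} := by
  rintro _ ⟨hz, t, rfl⟩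
  by_contra hne
  simp only [mem_insert_iff, mem_singleton_iff, not_or] at hne
  exact h.disjoint_arc_interior_drawnSet hS he heS ⟨t,
    ⟨unitInterval.pos_iff_ne_zero.2 fun h => hne.1 (by rw [h]),
      unitInterval.lt_one_iff_ne_one.2 fun h => hne.2 (by rw [h])⟩, rfl⟩ hz

theorem zero_and_one_mem_drawnSet (h : IsDrawing φ γ E) {e : Sym2 V} (he : e ∈ E) :
    γ e 0 ∈ drawnSet φ γ univ S ∧ γ e 1 ∈ drawnSet φ γ univ S := by
  obtain ⟨a, b, -, ha, hb⟩ := h.exists_ends e he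
  exact ⟨ha ▸ vertex_mem_drawnSet (mem_univ _), hb ▸ vertex_mem_drawnSet (mem_univ _)⟩

theorem mem_connectedComponentIn_of_reachable (h : IsDrawing φ γ E) (hS : S ⊆ E) {a b : V}
    (hab : (SimpleGraph.fromEdgeSet (S : Set (Sym2 V))).Reachable a b) :
    φ b ∈ connectedComponentIn (drawnSet φ γ univ S) (φ a) := by
  obtain ⟨p⟩ := hab
  induction p with
  | nil => exact mem_connectedComponentIn (vertex_mem_drawnSet (mem_univ _))
  | @cons u v w huv p ih =>
    rw [SimpleGraph.fromEdgeSet_adj] at huv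
    have heE := hS huv.1
    have hsub : range (γ s(u, v)) ⊆ drawnSet φ γ univ S := by
      rintro _ ⟨t, rfl⟩
      exact arc_mem_drawnSet huv.1 t
    have hconn := isPreconnected_range (h.continuous _ heE)
    have hmem : φ u ∈ range (γ s(u, v)) ∧ φ v ∈ range (γ s(u, v)) := by
      obtain ⟨a, b, hab, ha, hb⟩ := h.exists_ends _ heE
      rcases Sym2.eq_iff.1 hab with ⟨rfl, rfl⟩ | ⟨rfl, rfl⟩
      · exact ⟨⟨0, ha⟩, ⟨1, hb⟩⟩
      · exact ⟨⟨1, hb⟩, ⟨0, ha⟩⟩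
    rw [connectedComponentIn_eq (hconn.subset_connectedComponentIn hmem.1 hsub hmem.2)]
    exact ih

end IsDrawing

theorem HasLogOn.union_of_inter_subset_singleton {f : ℂ → ℂ} {K L : Set ℂ} {p : ℂ}
    (hf : HasLogOn f K) (hf' : HasLogOn f L) (hK : IsClosed K) (hL : IsClosed L)
    (hKL : K ∩ L ⊆ {p}) : HasLogOn f (K ∪ L) := by
  obtain ⟨u, hu, hfu⟩ := hf
  obtain ⟨v, hv, hfv⟩ := hf'
  by_cases hp : p ∈ K ∩ L
  · refine HasLogOn.union_of_eqOn (v := fun z => v z + (u p - v p)) hK hL hu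
      (hv.add continuousOn_const) hfu ?_ ?_
    · intro z hz
      rw [exp_add, exp_sub, ← hfu p hp.1, ← hfv p hp.2, div_self, mul_one, hfv z hz]
      rw [hfu p hp.1]
      exact exp_ne_zero _
    · intro z hz
      rw [hKL hz]
      ring
  · exact HasLogOn.union_of_eqOn hK hL hu hv hfu hfv fun z hz => absurd (hKL hz ▸ hz) hp

namespace IsDrawing

variable {φ : V → ℂ} {γ : Sym2 V → unitInterval → ℂ} {E S T : Finset (Sym2 V)} {C : Set V}

theorem hasLogOn_of_isAcyclic [Finite V] (h : IsDrawing φ γ E)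
    (hE : (SimpleGraph.fromEdgeSet (E : Set (Sym2 V))).IsAcyclic) {f : ℂ → ℂ}
    (hf : ContinuousOn f (drawnSet φ γ univ E)) (h0 : ∀ z ∈ drawnSet φ γ univ E, f z ≠ 0) :
    HasLogOn f (drawnSet φ γ univ E) := by
  classical
  induction E using Finset.induction_on with
  | empty =>
    refine ⟨fun z => log (f z), Set.Finite.continuousOn ?_ _, fun z hz => (exp_log (h0 z hz)).symm⟩
    simpa [drawnSet] using finite_range φ
  | insert e S heS ih =>
    have hS : S ⊆ insert e S := Finset.subset_insert e S
    have he : e ∈ insert e S := Finset.mem_insert_self e S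
    have hle : SimpleGraph.fromEdgeSet (S : Set (Sym2 V)) ≤
        SimpleGraph.fromEdgeSet ((insert e S : Finset (Sym2 V)) : Set (Sym2 V)) :=
      SimpleGraph.fromEdgeSet_mono (by exact_mod_cast hS)
    have hlog := ih (h.mono hS) (hE.anti hle) (hf.mono (drawnSet_mono Subset.rfl hS))
      fun z hz => h0 z (drawnSet_mono Subset.rfl hS hz)
    obtain ⟨a, b, rfl, ha, hb⟩ := h.exists_ends e he
    have hab : a ≠ b := by
      rintro rfl
      exact zero_ne_one (h.injective _ he (ha.trans hb.symm))
    have hnr : ¬ (SimpleGraph.fromEdgeSet (S : Set (Sym2 V))).Reachable a b := by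
      have hadj : (SimpleGraph.fromEdgeSet
          ((insert s(a, b) S : Finset (Sym2 V)) : Set (Sym2 V))).Adj a b := by simp [hab]
      have hbr := SimpleGraph.isBridge_iff.1
        (SimpleGraph.isAcyclic_iff_forall_adj_isBridge.1 hE hadj)
      refine fun hr => hbr (hr.mono ?_)
      intro x y hxy
      rw [SimpleGraph.fromEdgeSet_adj] at hxy
      rw [SimpleGraph.deleteEdges_adj, SimpleGraph.fromEdgeSet_adj]
      exact ⟨⟨hS hxy.1, hxy.2⟩, fun hxe => heS (hxe ▸ hxy.1)⟩
    have hrange : range (γ s(a, b)) ⊆ drawnSet φ γ univ (insert s(a, b) S) := by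
      rintro _ ⟨t, rfl⟩
      exact arc_mem_drawnSet he t
    have hlogA := hasLogOn_range_of_injective (h.continuous _ he) (h.injective _ he)
      (hf.mono hrange) fun z hz => h0 z (hrange hz)
    let C : Set V := {v | (SimpleGraph.fromEdgeSet (S : Set (Sym2 V))).Reachable a v}
    let S₁ := S.filter fun e => ∀ v ∈ e, v ∈ C
    let S₂ := S.filter fun e => ∀ v ∈ e, v ∉ C
    have hS₁ : S₁ ⊆ insert s(a, b) S := (Finset.filter_subset _ _).trans hS
    have hS₂ : S₂ ⊆ insert s(a, b) S := (Finset.filter_subset _ _).trans hS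
    have heS₁ : s(a, b) ∉ S₁ := fun h => heS (Finset.filter_subset _ _ h)
    have heS₂ : s(a, b) ∉ S₂ := fun h => heS (Finset.filter_subset _ _ h)
    have hsplit : drawnSet φ γ univ S = drawnSet φ γ C S₁ ∪ drawnSet φ γ Cᶜ S₂ := by
      refine Subset.antisymm ?_ (union_subset
        (drawnSet_mono (subset_univ _) (Finset.filter_subset _ _))
        (drawnSet_mono (subset_univ _) (Finset.filter_subset _ _)))
      rintro z (⟨v, -, rfl⟩ | hz)
      · by_cases hv : v ∈ C
        · exact .inl (vertex_mem_drawnSet hv)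
        · exact .inr (vertex_mem_drawnSet hv)
      · obtain ⟨e, heS', t, rfl⟩ := mem_iUnion₂.1 hz
        obtain ⟨x, y, rfl, hx, hy⟩ := h.exists_ends e (hS heS')
        have hxy : x ≠ y := by
          rintro rfl
          exact zero_ne_one (h.injective _ (hS heS') (hx.trans hy.symm))
        have hadj : (SimpleGraph.fromEdgeSet (S : Set (Sym2 V))).Adj x y := by
          rw [SimpleGraph.fromEdgeSet_adj]
          exact ⟨heS', hxy⟩
        by_cases hxC : x ∈ C
        · have hyC : y ∈ C := SimpleGraph.Reachable.trans hxC hadj.reachable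
          exact .inl (arc_mem_drawnSet (by simp [S₁, heS', hxC, hyC]) t)
        · have hyC : y ∉ C := fun hy => hxC (SimpleGraph.Reachable.trans hy hadj.symm.reachable)
          exact .inr (arc_mem_drawnSet (by simp [S₂, heS', hxC, hyC]) t)
    have haC : a ∈ C := SimpleGraph.Reachable.refl a
    have hbC : b ∉ C := hnr
    have hb₁ : φ b ∉ drawnSet φ γ C S₁ := fun hmem => by
      rcases h.mem_of_vertex_mem_drawnSet hS₁ hmem with h | ⟨e, he, hbe⟩
      · exact hbC h
      · exact hbC ((Finset.mem_filter.1 he).2 b hbe)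
    have ha₂ : φ a ∉ drawnSet φ γ Cᶜ S₂ := fun hmem => by
      rcases h.mem_of_vertex_mem_drawnSet hS₂ hmem with h | ⟨e, he, hbe⟩
      · exact h haC
      · exact (Finset.mem_filter.1 he).2 a hbe haC
    have hdisj : Disjoint (drawnSet φ γ C S₁) (drawnSet φ γ Cᶜ S₂) := by
      rw [Set.disjoint_left]
      rintro _ (⟨v, hv, rfl⟩ | hz) hz'
      · rcases h.mem_of_vertex_mem_drawnSet hS₂ hz' with h | ⟨e, he, hbe⟩
        · exact h hv
        · exact (Finset.mem_filter.1 he).2 v hbe hv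
      · obtain ⟨e, he, t, rfl⟩ := mem_iUnion₂.1 hz
        have heC := (Finset.mem_filter.1 he).2
        have : e ∉ S₂ := fun h2 => by
          obtain ⟨x, y, rfl, -, -⟩ := h.exists_ends e (hS₁ he)
          exact (Finset.mem_filter.1 h2).2 x (by simp) (heC x (by simp))
        obtain ⟨v, hv, hvt⟩ := h.exists_vertex_of_mem_drawnSet_of_arc_eq hS₂ (hS₁ he) this hz'
        rw [hvt] at hz'
        rcases h.mem_of_vertex_mem_drawnSet hS₂ hz' with h | ⟨e', he', hbe⟩
        · exact h (heC v hv)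
        · exact (Finset.mem_filter.1 he').2 v hbe (heC v hv)
    have hi₁ := h.drawnSet_inter_range_subset (C := C) hS₁ he heS₁
    have hi₂ := h.drawnSet_inter_range_subset (C := Cᶜ) hS₂ he heS₂
    rw [ha, hb] at hi₁ hi₂
    have hlog₁ := (hlog.mono (hsplit ▸ subset_union_left)).union_of_inter_subset_singleton hlogA
      (h.isCompact_drawnSet hS₁).isClosed (isCompact_range (h.continuous _ he)).isClosed
      (p := φ a) fun z hz => (hi₁ hz).resolve_right fun hzb => hb₁ (hzb ▸ hz.1)
    have hlog₂ := hlog₁.union_of_inter_subset_singleton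
      (hlog.mono (hsplit ▸ subset_union_right))
      ((h.isCompact_drawnSet hS₁).isClosed.union (isCompact_range (h.continuous _ he)).isClosed)
      (h.isCompact_drawnSet hS₂).isClosed (p := φ b) (by
        rintro z ⟨h1 | h1, h2⟩
        · exact absurd h2 (Set.disjoint_left.1 hdisj h1)
        · exact (hi₂ ⟨h2, h1⟩).resolve_left fun hza => ha₂ (hza ▸ h2))
    rw [drawnSet_insert, hsplit]
    refine hlog₂.mono ?_
    rintro z ((hz | hz) | hz)
    · exact .inl (.inl hz)
    · exact .inr hz
    · exact .inl (.inr hz)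

theorem isPreconnected_compl_drawnSet_of_isAcyclic [Finite V] (h : IsDrawing φ γ E)
    (hE : (SimpleGraph.fromEdgeSet (E : Set (Sym2 V))).IsAcyclic) :
    IsPreconnected (drawnSet φ γ univ E)ᶜ := by
  rcases (drawnSet φ γ univ E)ᶜ.eq_empty_or_nonempty with hempty | ⟨a, ha⟩
  · rw [hempty]
    exact isPreconnected_empty
  have : (drawnSet φ γ univ E)ᶜ = connectedComponentIn (drawnSet φ γ univ E)ᶜ a := by
    refine Subset.antisymm (fun b hb => ?_) (connectedComponentIn_subset _ _)
    have hne : ∀ {x}, x ∈ (drawnSet φ γ univ E)ᶜ → ∀ z ∈ drawnSet φ γ univ E, z - x ≠ 0 :=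
      fun hx z hz h => hx (sub_eq_zero.1 h ▸ hz)
    rw [connectedComponentIn_eq_of_hasLogOn (h.isCompact_drawnSet Finset.Subset.rfl) ha hb
      (h.hasLogOn_of_isAcyclic hE (ContinuousOn.div (by fun_prop) (by fun_prop) (hne hb))
        fun z hz => div_ne_zero (hne ha z hz) (hne hb z hz))]
    exact mem_connectedComponentIn hb
  rw [this]
  exact isPreconnected_connectedComponentIn

theorem card_le_two_of_closure_inter_nonempty [Finite V] (h : IsDrawing φ γ E) {P : Finset ℂ}
    (hP : ∀ x ∈ P, x ∉ drawnSet φ γ univ E)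
    (hinj : InjOn (connectedComponentIn (drawnSet φ γ univ E)ᶜ) P) {e : Sym2 V} (he : e ∈ E)
    (hinc : ∀ x ∈ P,
      (closure (connectedComponentIn (drawnSet φ γ univ E)ᶜ x) ∩ γ e '' Ioo 0 1).Nonempty) :
    P.card ≤ 2 := by
  classical
  by_contra! hcard
  obtain ⟨a, ha, b, hb, c, hc, hab, hac, hbc⟩ := Finset.two_lt_card.1 hcard
  have hS : E.erase e ⊆ E := Finset.erase_subset _ _
  have heS : e ∉ E.erase e := Finset.notMem_erase _ _
  have hKc := h.isCompact_drawnSet (C := univ) hS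
  have hX : drawnSet φ γ univ E = drawnSet φ γ univ (E.erase e) ∪ range (γ e) := by
    rw [← drawnSet_insert, Finset.insert_erase he]
  set K := drawnSet φ γ univ (E.erase e) with hK
  have hio := h.disjoint_arc_interior_drawnSet (C := univ) hS he heS
  have hconn : IsPreconnected (γ e '' Ioo 0 1) :=
    isPreconnected_Ioo.image _ (h.continuous e he).continuousOn
  obtain ⟨-, -, w, hw, rfl⟩ := hinc a ha
  have hmem : ∀ x ∈ P, x ∈ connectedComponentIn Kᶜ (γ e w) \ range (γ e) := by
    intro x hx
    have hxX : x ∈ (drawnSet φ γ univ E)ᶜ := hP x hx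
    refine ⟨?_, fun hxr => hxX (hX ▸ .inr hxr)⟩
    obtain ⟨z, hz, hze⟩ := hinc x hx
    have hzU := hconn.subset_connectedComponentIn ⟨w, hw, rfl⟩ hio hze
    obtain ⟨y, hyU, hyx⟩ := mem_closure_iff.1 hz _
      hKc.isClosed.isOpen_compl.connectedComponentIn hzU
    have hyx' := connectedComponentIn_mono x
      (compl_subset_compl.2 (hX ▸ subset_union_left : K ⊆ drawnSet φ γ univ E)) hyx
    rw [connectedComponentIn_eq hyU, ← connectedComponentIn_eq hyx']
    exact mem_connectedComponentIn fun hxK => hxX (hX ▸ .inl hxK)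
  have h01 := h.zero_and_one_mem_drawnSet (S := E.erase e) he
  rw [hX] at hinj
  rcases exists_connectedComponentIn_eq_of_isPreconnected hKc (h.continuous e he) (h.injective e he)
    h01.1 h01.2 (h.drawnSet_inter_range_subset hS he heS) isPreconnected_connectedComponentIn
    (connectedComponentIn_subset _ _) (hmem a ha) (hmem b hb) (hmem c hc) with h1 | h1 | h1
  · exact hab (hinj ha hb h1)
  · exact hac (hinj ha hc h1)
  · exact hbc (hinj hb hc h1)

theorem subset_of_isAcyclic [Finite V] (h : IsDrawing φ γ E) (hT : T ⊆ E)
    (hac : (SimpleGraph.fromEdgeSet (T : Set (Sym2 V))).IsAcyclic) {x : ℂ}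
    (hx : x ∉ drawnSet φ γ univ E)
    (hinc : ∀ e ∈ E,
      (closure (connectedComponentIn (drawnSet φ γ univ E)ᶜ x) ∩ γ e '' Ioo 0 1).Nonempty → e ∈ T) :
    E ⊆ T := by
  have hE := h.isCompact_drawnSet (C := univ) Finset.Subset.rfl
  have hopen : IsOpen (connectedComponentIn (drawnSet φ γ univ E)ᶜ x) :=
    hE.isClosed.isOpen_compl.connectedComponentIn
  have hmono : drawnSet φ γ univ T ⊆ drawnSet φ γ univ E := drawnSet_mono Subset.rfl hT
  have hsub : (drawnSet φ γ univ T)ᶜ ⊆ connectedComponentIn (drawnSet φ γ univ E)ᶜ x := by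
    refine ((h.mono hT).isPreconnected_compl_drawnSet_of_isAcyclic hac).subset_of_closure_inter_subset
      hopen ⟨x, fun hxT => hx (hmono hxT), mem_connectedComponentIn hx⟩ ?_
    rintro z ⟨hzc, hzT⟩
    by_contra hz
    rcases hE.isClosed.frontier_connectedComponentIn_compl_subset x
      ⟨hzc, by rwa [hopen.interior_eq]⟩ with ⟨v, hv, rfl⟩ | hze
    · exact hzT (vertex_mem_drawnSet hv)
    · obtain ⟨e, he, t, rfl⟩ := mem_iUnion₂.1 hze
      have heT : e ∉ T := fun heT => hzT (arc_mem_drawnSet heT t)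
      have h01 := h.zero_and_one_mem_drawnSet (S := T) he
      refine heT (hinc e he ⟨γ e t, hzc, t, ⟨unitInterval.pos_iff_ne_zero.2 ?_,
        unitInterval.lt_one_iff_ne_one.2 ?_⟩, rfl⟩)
      · rintro rfl
        exact hzT h01.1
      · rintro rfl
        exact hzT h01.2
  intro e he
  by_contra heT
  obtain ⟨t, ht⟩ : (Ioo (0 : unitInterval) 1).Nonempty := nonempty_Ioo.2 zero_lt_one
  exact connectedComponentIn_subset _ _
    (hsub (h.disjoint_arc_interior_drawnSet hT he heT ⟨t, ht, rfl⟩)) (arc_mem_drawnSet he t)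

theorem exists_card_add_one_le_of_reachable [Finite V] [DecidableEq V] (h : IsDrawing φ γ E)
    (hS : S ⊆ E) {a b : V} (he : s(a, b) ∈ E) (heS : s(a, b) ∉ S)
    (hab : (SimpleGraph.fromEdgeSet (S : Set (Sym2 V))).Reachable a b) {P : Finset ℂ}
    (hP : ∀ x ∈ P, x ∉ drawnSet φ γ univ S)
    (hinj : InjOn (connectedComponentIn (drawnSet φ γ univ S)ᶜ) P) :
    ∃ Q : Finset ℂ, (∀ x ∈ Q, x ∉ drawnSet φ γ univ (insert s(a, b) S)) ∧
      InjOn (connectedComponentIn (drawnSet φ γ univ (insert s(a, b) S))ᶜ) Q ∧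
      P.card + 1 ≤ Q.card := by
  classical
  have hX : drawnSet φ γ univ (insert s(a, b) S) = drawnSet φ γ univ S ∪ range (γ s(a, b)) :=
    drawnSet_insert _
  have hKc := h.isCompact_drawnSet (C := univ) hS
  have hio := h.disjoint_arc_interior_drawnSet (C := univ) hS he heS
  have hconn : IsPreconnected (γ s(a, b) '' Ioo 0 1) :=
    isPreconnected_Ioo.image _ (h.continuous _ he).continuousOn
  have hreach := h.mem_connectedComponentIn_of_reachable hS hab
  have ha₀ : φ a ∈ drawnSet φ γ univ S := vertex_mem_drawnSet (mem_univ _)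
  have h01 := h.zero_and_one_mem_drawnSet (S := S) he
  have hγ01 : ({γ s(a, b) 0, γ s(a, b) 1} : Set ℂ) = {φ a, φ b} := by
    obtain ⟨x, y, hxy, hx, hy⟩ := h.exists_ends _ he
    rcases Sym2.eq_iff.1 hxy with ⟨rfl, rfl⟩ | ⟨rfl, rfl⟩
    · rw [hx, hy]
    · rw [hx, hy, pair_comm]
  have hne : φ a ≠ φ b := by
    intro hab
    rw [hab, pair_eq_singleton] at hγ01
    have h0 : γ s(a, b) 0 ∈ ({φ b} : Set ℂ) := hγ01 ▸ mem_insert _ _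
    have h1 : γ s(a, b) 1 ∈ ({φ b} : Set ℂ) := hγ01 ▸ mem_insert_of_mem _ rfl
    exact zero_ne_one (h.injective _ he (h0.trans h1.symm))
  have hend : ∀ z ∈ ({φ a, φ b} : Set ℂ), z ∈ range (γ s(a, b)) := by
    rw [← hγ01]
    rintro z (rfl | rfl) <;> exact mem_range_self _
  set K := drawnSet φ γ univ S with hK
  set A := range (γ s(a, b)) with hA
  obtain ⟨t₀, ht₀⟩ : (Ioo (0 : unitInterval) 1).Nonempty := nonempty_Ioo.2 zero_lt_one
  set U := connectedComponentIn Kᶜ (γ s(a, b) t₀) with hU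
  have hUo : IsOpen U := hKc.isClosed.isOpen_compl.connectedComponentIn
  have hUK : U ⊆ Kᶜ := connectedComponentIn_subset _ _
  have hAU : A ⊆ U ∪ {φ a, φ b} := by
    rintro _ ⟨t, rfl⟩
    rw [← hγ01]
    by_cases h0 : t = 0
    · simp [h0]
    by_cases h1 : t = 1
    · simp [h1]
    exact .inl (hconn.subset_connectedComponentIn ⟨t₀, ht₀, rfl⟩ hio
      ⟨t, ⟨unitInterval.pos_iff_ne_zero.2 h0, unitInterval.lt_one_iff_ne_one.2 h1⟩, rfl⟩)
  have hnot : ¬ IsPreconnected (U \ A) :=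
    not_isPreconnected_diff_of_isCompact hUo (isCompact_range (h.continuous _ he))
      (isPreconnected_range (h.continuous _ he)) isPreconnected_connectedComponentIn
      (Set.disjoint_left.2 fun z hz hzU => hUK hzU (connectedComponentIn_subset _ _ hz)) hne
      (mem_connectedComponentIn ha₀) hreach (hend _ (by simp)) (hend _ (by simp)) hAU
  have hmono : ∀ x, connectedComponentIn (K ∪ A)ᶜ x ⊆ connectedComponentIn Kᶜ x := fun x =>
    connectedComponentIn_mono x (compl_subset_compl.2 subset_union_left)
  have hUA : ∀ {x}, x ∈ U \ A → x ∈ (K ∪ A)ᶜ := fun hx h => h.elim (hUK hx.1) hx.2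
  obtain ⟨x, hx, y, hy, hxy⟩ : ∃ x ∈ U \ A, ∃ y ∈ U \ A,
      connectedComponentIn (K ∪ A)ᶜ x ≠ connectedComponentIn (K ∪ A)ᶜ y := by
    by_contra! hall
    rcases (U \ A).eq_empty_or_nonempty with hempty | ⟨x, hx⟩
    · exact hnot (hempty ▸ isPreconnected_empty)
    refine hnot ?_
    have : U \ A = connectedComponentIn (K ∪ A)ᶜ x := by
      refine Subset.antisymm (fun y hy => ?_) fun y hy => ⟨?_, fun hyA =>
        connectedComponentIn_subset _ _ hy (.inr hyA)⟩
      · rw [hall x hx y hy]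
        exact mem_connectedComponentIn (hUA hy)
      · rw [hU, connectedComponentIn_eq hx.1]
        exact hmono x hy
    rw [this]
    exact isPreconnected_connectedComponentIn
  have hcomp : ∀ {z w}, w ∈ (K ∪ A)ᶜ →
      connectedComponentIn (K ∪ A)ᶜ z = connectedComponentIn (K ∪ A)ᶜ w →
      connectedComponentIn Kᶜ z = connectedComponentIn Kᶜ w := fun {z w} hw hzw =>
    connectedComponentIn_eq (hmono z (hzw ▸ mem_connectedComponentIn hw))
  have hfar : ∀ {z w}, z ∉ K → z ∉ U → w ∈ U \ A →
      connectedComponentIn (K ∪ A)ᶜ z ≠ connectedComponentIn (K ∪ A)ᶜ w := by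
    intro z w hzK hzU hw hzw
    refine hzU ?_
    rw [hU, connectedComponentIn_eq hw.1, ← hcomp (hUA hw) hzw]
    exact mem_connectedComponentIn hzK
  have hxyne : x ≠ y := fun h => hxy (by rw [h])
  have hPA : ∀ z ∈ P, z ∉ U → z ∈ (K ∪ A)ᶜ := by
    rintro z hz hzU (hzK | hzA)
    · exact hP z hz hzK
    · rcases hAU hzA with h1 | h1
      · exact hzU h1
      · rcases hγ01 ▸ h1 with h1 | h1
        · exact hP z hz (h1 ▸ h01.1)
        · exact hP z hz (h1 ▸ h01.2)
  rw [hX]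
  refine ⟨insert x (insert y (P.filter fun z => z ∉ U)), ?_, ?_, ?_⟩
  · intro z hz
    simp only [Finset.mem_insert, Finset.mem_filter] at hz
    rcases hz with rfl | rfl | ⟨hz, hzU⟩
    · exact hUA hx
    · exact hUA hy
    · exact hPA z hz hzU
  · intro z hz w hw hzw
    simp only [Finset.coe_insert, Finset.coe_filter, mem_insert_iff, mem_ofPred_eq] at hz hw
    rcases hz with rfl | rfl | ⟨hz, hzU⟩ <;> rcases hw with rfl | rfl | ⟨hw, hwU⟩
    · rfl
    · exact absurd hzw hxy
    · exact absurd hzw.symm (hfar (hP w hw) hwU hx)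
    · exact absurd hzw.symm hxy
    · rfl
    · exact absurd hzw.symm (hfar (hP w hw) hwU hy)
    · exact absurd hzw (hfar (hP z hz) hzU hx)
    · exact absurd hzw (hfar (hP z hz) hzU hy)
    · exact hinj hz hw (hcomp (hPA w hw hwU) hzw)
  · have hone : (P.filter fun z => z ∈ U).card ≤ 1 := by
      rw [Finset.card_le_one]
      intro z hz w hw
      rw [Finset.mem_filter] at hz hw
      exact hinj hz.1 hw.1 ((connectedComponentIn_eq hz.2).symm.trans (connectedComponentIn_eq hw.2))
    have hsum := P.card_filter_add_card_filter_not (fun z => z ∈ U)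
    rw [Finset.card_insert_of_notMem, Finset.card_insert_of_notMem]
    · omega
    · simp [hy.1]
    · simp [hxyne, hx.1]

theorem exists_card_add_one_le [Fintype V] [Nonempty V] (h : IsDrawing φ γ E) :
    ∃ P : Finset ℂ, (∀ x ∈ P, x ∉ drawnSet φ γ univ E) ∧
      InjOn (connectedComponentIn (drawnSet φ γ univ E)ᶜ) P ∧
      E.card + 2 ≤ P.card + Fintype.card V := by
  classical
  obtain ⟨F, hFG, hF, hreach⟩ := SimpleGraph.exists_isAcyclic_reachable_eq_le
    (G := SimpleGraph.fromEdgeSet (E : Set (Sym2 V)))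
  have hT : F.edgeFinset ⊆ E := by
    intro e he
    have := SimpleGraph.edgeSet_mono hFG (SimpleGraph.mem_edgeFinset.1 he)
    rw [SimpleGraph.edgeSet_fromEdgeSet] at this
    exact this.1
  have hTc : F.edgeFinset.card + 1 ≤ Fintype.card V := by
    obtain ⟨T, hFT, -, hTt⟩ := SimpleGraph.Connected.exists_isTree_le_of_le_of_isAcyclic
      SimpleGraph.connected_top le_top hF
    rw [← hTt.card_edgeFinset]
    exact Nat.succ_le_succ (Finset.card_le_card (SimpleGraph.edgeFinset_mono hFT))
  suffices ∀ D : Finset (Sym2 V), D ⊆ E → Disjoint D F.edgeFinset → ∃ P : Finset ℂ,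
      (∀ x ∈ P, x ∉ drawnSet φ γ univ (D ∪ F.edgeFinset)) ∧
      InjOn (connectedComponentIn (drawnSet φ γ univ (D ∪ F.edgeFinset))ᶜ) P ∧
      D.card + 1 ≤ P.card by
    obtain ⟨P, h1, h2, h3⟩ := this _ Finset.sdiff_subset Finset.sdiff_disjoint
    rw [Finset.sdiff_union_of_subset hT] at h1 h2
    refine ⟨P, h1, h2, ?_⟩
    rw [Finset.card_sdiff_of_subset hT] at h3
    omega
  intro D
  induction D using Finset.induction_on with
  | empty =>
    intro _ _
    rw [Finset.empty_union]
    obtain ⟨x, hx⟩ : ∃ x, x ∉ drawnSet φ γ univ F.edgeFinset := by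
      by_contra! hall
      exact noncompact_univ ℂ (eq_univ_of_forall hall ▸ h.isCompact_drawnSet hT)
    exact ⟨{x}, by simpa using hx, by simp, by simp⟩
  | insert e D he ih =>
    intro hDE hdisj
    obtain ⟨P, h1, h2, h3⟩ := ih ((Finset.subset_insert _ _).trans hDE)
      (hdisj.mono_left (Finset.subset_insert _ _))
    have heE := hDE (Finset.mem_insert_self _ _)
    obtain ⟨a, b, rfl, ha, hb⟩ := h.exists_ends e heE
    have hab : a ≠ b := by
      rintro rfl
      exact zero_ne_one (h.injective _ heE (ha.trans hb.symm))
    have heF : s(a, b) ∉ F.edgeFinset :=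
      Finset.disjoint_left.1 hdisj (Finset.mem_insert_self _ _)
    have hr : F.Reachable a b := by
      rw [hreach]
      refine SimpleGraph.Adj.reachable ?_
      rw [SimpleGraph.fromEdgeSet_adj]
      exact ⟨heE, hab⟩
    have hle : F ≤ SimpleGraph.fromEdgeSet ((D ∪ F.edgeFinset : Finset (Sym2 V)) : Set (Sym2 V)) := by
      intro x y hxy
      rw [SimpleGraph.fromEdgeSet_adj]
      exact ⟨by simp [hxy], hxy.ne⟩
    obtain ⟨Q, hQ1, hQ2, hQ3⟩ := h.exists_card_add_one_le_of_reachable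
      (Finset.union_subset ((Finset.subset_insert _ _).trans hDE) hT) heE
      (by simpa [he] using heF) (hr.mono hle) h1 h2
    rw [← Finset.insert_union] at hQ1 hQ2
    refine ⟨Q, hQ1, hQ2, ?_⟩
    rw [Finset.card_insert_of_notMem he]
    omega

theorem card_add_four_le [Fintype V] [Nonempty V] (h : IsDrawing φ γ E)
    (hgirth : 4 ≤ (SimpleGraph.fromEdgeSet (E : Set (Sym2 V))).egirth) (hE : 4 ≤ E.card) :
    E.card + 4 ≤ 2 * Fintype.card V := by
  classical
  obtain ⟨P, hP, hinj, hcard⟩ := h.exists_card_add_one_le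
  have key := Finset.card_mul_le_card_mul (s := P) (t := E) (m := 4) (n := 2)
    (fun x e => (closure (connectedComponentIn (drawnSet φ γ univ E)ᶜ x) ∩ γ e '' Ioo 0 1).Nonempty)
    (fun x hx => ?_) fun e he => ?_
  · omega
  · by_contra! hlt
    set T := Finset.bipartiteAbove (fun x e =>
      (closure (connectedComponentIn (drawnSet φ γ univ E)ᶜ x) ∩ γ e '' Ioo 0 1).Nonempty) E x with hTdef
    have hT : T ⊆ E := Finset.filter_subset _ _
    have hac : (SimpleGraph.fromEdgeSet (T : Set (Sym2 V))).IsAcyclic := by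
      intro v p hp
      have hle : SimpleGraph.fromEdgeSet (T : Set (Sym2 V)) ≤
          SimpleGraph.fromEdgeSet (E : Set (Sym2 V)) :=
        SimpleGraph.fromEdgeSet_mono (by exact_mod_cast hT)
      have h4 := SimpleGraph.le_egirth.1 hgirth v _ (hp.mapLe hle)
      rw [SimpleGraph.Walk.length_map] at h4
      have h4' : 4 ≤ p.length := by exact_mod_cast h4
      have hle' : p.edges.toFinset.card ≤ T.card := by
        refine Finset.card_le_card fun e he => ?_
        have := p.edges_subset_edgeSet (List.mem_toFinset.1 he)
        rw [SimpleGraph.edgeSet_fromEdgeSet] at this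
        exact this.1
      rw [List.toFinset_card_of_nodup hp.edges_nodup, SimpleGraph.Walk.length_edges] at hle'
      omega
    have := Finset.card_le_card (h.subset_of_isAcyclic hT hac (hP x hx) fun e he hinc =>
      Finset.mem_filter.2 ⟨he, hinc⟩)
    omega
  · refine h.card_le_two_of_closure_inter_nonempty (fun x hx => hP x (Finset.filter_subset _ _ hx))
      (hinj.mono ?_) he fun x hx => (Finset.mem_filter.1 hx).2
    exact_mod_cast Finset.filter_subset _ _

end IsDrawing

theorem SimpleGraph.IsPlanar.exists_isDrawing [Fintype V] {G : SimpleGraph V} [Fintype G.edgeSet]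
    (hG : G.IsPlanar) : ∃ φ γ, IsDrawing (V := V) φ γ G.edgeFinset := by
  obtain ⟨f, hf, P, hP, hvert, harc⟩ := hG
  let ψ : ℝ × ℝ → ℂ := equivRealProdCLM.symm
  have hψ : Function.Injective ψ := equivRealProdCLM.symm.injective
  have hψc : Continuous ψ := equivRealProdCLM.symm.continuous
  have key : ∀ e : Sym2 V, ∃ g : unitInterval → ℂ, e ∈ G.edgeSet →
      ∃ (u v : V) (h : G.Adj u v), e = s(u, v) ∧ g = ψ ∘ P h := by
    intro e
    induction e with
    | h u v =>
      by_cases h : G.Adj u v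
      · exact ⟨ψ ∘ P h, fun _ => ⟨u, v, h, rfl, rfl⟩⟩
      · exact ⟨fun _ => 0, fun h' => absurd h' h⟩
  choose γ hγ using key
  refine ⟨ψ ∘ f, γ, hψ.comp hf, ?_, ?_, ?_, ?_, ?_⟩
  · intro e he
    obtain ⟨u, v, h, rfl, hg⟩ := hγ e (SimpleGraph.mem_edgeFinset.1 he)
    rw [hg]
    exact hψc.comp (P h).continuous
  · intro e he
    obtain ⟨u, v, h, rfl, hg⟩ := hγ e (SimpleGraph.mem_edgeFinset.1 he)
    rw [hg]
    exact hψ.comp (hP h)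
  · intro e he
    obtain ⟨u, v, h, rfl, hg⟩ := hγ e (SimpleGraph.mem_edgeFinset.1 he)
    exact ⟨u, v, rfl, by simp [hg], by simp [hg]⟩
  · intro e he t ht w
    obtain ⟨u, v, h, rfl, hg⟩ := hγ e (SimpleGraph.mem_edgeFinset.1 he)
    rw [hg]
    exact hψ.ne (hvert h t ht.1.ne' ht.2.ne w)
  · intro e he e' he' hee t ht s
    obtain ⟨u, v, h, rfl, hg⟩ := hγ e (SimpleGraph.mem_edgeFinset.1 he)
    obtain ⟨u', v', h', rfl, hg'⟩ := hγ e' (SimpleGraph.mem_edgeFinset.1 he')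
    rw [hg, hg']
    exact hψ.ne (harc h h' hee t s ht.1.ne' ht.2.ne)

/-- A planar graph of girth at least 4 on `n ≥ 4` vertices has at most `2n - 4` edges. -/
theorem SimpleGraph.IsPlanar.card_edgeFinset_add_four_le [Fintype V] {G : SimpleGraph V}
    [Fintype G.edgeSet] (hG : G.IsPlanar) (hgirth : 4 ≤ G.egirth) (hV : 4 ≤ Fintype.card V) :
    G.edgeFinset.card + 4 ≤ 2 * Fintype.card V := by
  obtain hE | hE := Nat.lt_or_ge G.edgeFinset.card 4
  · omega
  · obtain ⟨φ, γ, h⟩ := hG.exists_isDrawing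
    have : Nonempty V := Fintype.card_pos_iff.1 (by omega)
    refine h.card_add_four_le ?_ hE
    rwa [SimpleGraph.coe_edgeFinset, SimpleGraph.fromEdgeSet_edgeSet]

section axisPoint

/-- The point at signed distance `c` from the origin, on the first axis if `c` is even and on the
second axis if `c` is odd. -/
noncomputable def axisPoint (c : ℤ) : ℝ × ℝ :=
  if Even c then ((c : ℝ), 0) else (0, (c : ℝ))

theorem axisPoint_of_even {c : ℤ} (hc : Even c) : axisPoint c = ((c : ℝ), 0) := if_pos hc

theorem axisPoint_of_not_even {c : ℤ} (hc : ¬Even c) : axisPoint c = (0, (c : ℝ)) := if_neg hc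

theorem axisPoint_fst_add_snd (c : ℤ) : (axisPoint c).1 + (axisPoint c).2 = c := by
  by_cases hc : Even c
  · simp [axisPoint_of_even hc]
  · simp [axisPoint_of_not_even hc]

theorem axisPoint_fst_mul_snd (c : ℤ) : (axisPoint c).1 * (axisPoint c).2 = 0 := by
  by_cases hc : Even c
  · simp [axisPoint_of_even hc]
  · simp [axisPoint_of_not_even hc]

theorem axisPoint_injective : Function.Injective axisPoint := by
  intro a b hab
  have := axisPoint_fst_add_snd a
  rw [hab, axisPoint_fst_add_snd] at this
  exact_mod_cast this.symm


/-- Distinct segments joining points of the two axes whose distances to the origin are consecutive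
integers do not cross. -/
theorem eq_and_eq_of_mul_eq_mul {a b a' b' : ℤ} {x y x' y' : ℝ} (ha : Even a) (hb : ¬Even b)
    (ha' : Even a') (hb' : ¬Even b') (ha₀ : a ≠ 0) 
    (hab : |a| = |b| + 1 ∨ |b| = |a| + 1) (hab' : |a'| = |b'| + 1 ∨ |b'| = |a'| + 1)
    (hx : 0 < x) (hy : 0 < y) (hxy : x + y = 1) (hx' : 0 ≤ x') (hy' : 0 ≤ y') (hxy' : x' + y' = 1)
    (hxx : x * a = x' * a') (hyy : y * b = y' * b') : a = a' ∧ b = b' := by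
  have hb₀ : b ≠ 0 := by rintro rfl; simp at hb
  have hx'₀ : 0 < x' := by
    refine hx'.lt_of_ne fun h => ?_
    rw [← h, zero_mul] at hxx
    exact (mul_ne_zero hx.ne' (by exact_mod_cast ha₀)) hxx
  have hy'₀ : 0 < y' := by
    refine hy'.lt_of_ne fun h => ?_
    rw [← h, zero_mul] at hyy
    exact (mul_ne_zero hy.ne' (by exact_mod_cast hb₀)) hyy
  have hxa : x * |(a : ℝ)| = x' * |(a' : ℝ)| := by
    rw [← abs_of_pos hx, ← abs_of_pos hx'₀, ← abs_mul, ← abs_mul, hxx]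
  have hyb : y * |(b : ℝ)| = y' * |(b' : ℝ)| := by
    rw [← abs_of_pos hy, ← abs_of_pos hy'₀, ← abs_mul, ← abs_mul, hyy]
  have ea : Even |a| := even_abs.2 ha
  have ea' : Even |a'| := even_abs.2 ha'
  have eb : ¬Even |b| := mt even_abs.1 hb
  have eb' : ¬Even |b'| := mt even_abs.1 hb'
  suffices h : |a| = |a'| ∧ |b| = |b'| by
    have hap : 0 < |(a : ℝ)| := abs_pos.2 (by exact_mod_cast ha₀)
    have hbp : 0 < |(b : ℝ)| := abs_pos.2 (by exact_mod_cast hb₀)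
    have h1 : |(a : ℝ)| = |(a' : ℝ)| := by exact_mod_cast h.1
    have h2 : |(b : ℝ)| = |(b' : ℝ)| := by exact_mod_cast h.2
    rw [← h1] at hxa
    rw [← h2] at hyb
    have h3 := mul_right_cancel₀ hap.ne' hxa
    have h4 := mul_right_cancel₀ hbp.ne' hyb
    rw [← h3] at hxx
    rw [← h4] at hyy
    exact ⟨by exact_mod_cast mul_left_cancel₀ hx.ne' hxx,
      by exact_mod_cast mul_left_cancel₀ hy.ne' hyy⟩
  have hsum : x * |(a : ℝ)| + y * |(b : ℝ)| = x' * |(a' : ℝ)| + y' * |(b' : ℝ)| := by rw [hxa, hyb]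
  simp only [← Int.cast_abs] at hsum
  generalize |a| = A at *
  generalize |b| = B at *
  generalize |a'| = A' at *
  generalize |b'| = B' at *
  have hy1 : y = 1 - x := by linarith
  have hy1' : y' = 1 - x' := by linarith
  subst hy1 hy1'
  have low : min A B = min A' B' := by
    have key : ∀ {A B : ℤ} {x : ℝ}, (A = B + 1 ∨ B = A + 1) → 0 < x → 0 < 1 - x →
        ((min A B : ℤ) : ℝ) < x * A + (1 - x) * B ∧
          x * A + (1 - x) * B < ((min A B : ℤ) : ℝ) + 1 := by
      intro A B x h hx hx1
      obtain rfl | rfl := h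
      · rw [min_eq_right (by omega)]
        push_cast
        constructor <;> nlinarith
      · rw [min_eq_left (by omega)]
        push_cast
        constructor <;> nlinarith
    obtain ⟨h1, h2⟩ := key hab hx hy
    obtain ⟨h3, h4⟩ := key hab' hx'₀ hy'₀
    have h5 : ((min A B : ℤ) : ℝ) < ((min A' B' + 1 : ℤ) : ℝ) := by push_cast at *; linarith
    have h6 : ((min A' B' : ℤ) : ℝ) < ((min A B + 1 : ℤ) : ℝ) := by push_cast at *; linarith
    have h7 := Int.cast_lt.1 h5
    have h8 := Int.cast_lt.1 h6
    omega
  rw [Int.not_even_iff] at eb eb'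
  rw [Int.even_iff] at ea ea'
  omega

end axisPoint

namespace SimpleGraph

variable {G : SimpleGraph V} {c : V → ℤ}

theorem exists_segment_axisPoint_eq (hG : ∀ u v, G.Adj u v → |c u| = |c v| + 1 ∨ |c v| = |c u| + 1)
    {u v : V} (h : G.Adj u v) (t : unitInterval) :
    ∃ (a b : V) (x y : ℝ), s(u, v) = s(a, b) ∧ Even (c a) ∧ ¬Even (c b) ∧
      (|c a| = |c b| + 1 ∨ |c b| = |c a| + 1) ∧ 0 ≤ x ∧ 0 ≤ y ∧ x + y = 1 ∧
      (t ≠ 0 → t ≠ 1 → 0 < x ∧ 0 < y) ∧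
      Path.segment (axisPoint (c u)) (axisPoint (c v)) t = (x * c a, y * c b) := by
  have h0 : 0 ≤ (t : ℝ) := t.2.1
  have h1 : 0 ≤ 1 - (t : ℝ) := sub_nonneg.2 t.2.2
  have h0' : t ≠ 0 → 0 < (t : ℝ) := unitInterval.pos_iff_ne_zero.2
  have h1' : t ≠ 1 → 0 < 1 - (t : ℝ) := fun h => sub_pos.2 (unitInterval.lt_one_iff_ne_one.2 h)
  have hpar : Even (c u) ↔ ¬Even (c v) := by
    rw [← even_abs, ← even_abs (a := c v)]
    obtain h | h := hG u v h <;> rw [h, Int.even_add_one]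
    tauto
  by_cases hu : Even (c u)
  · have hv := hpar.1 hu
    refine ⟨u, v, 1 - t, t, rfl, hu, hv, hG u v h, h1, h0, by ring,
      fun h h' => ⟨h1' h', h0' h⟩, ?_⟩
    simp [axisPoint_of_even hu, axisPoint_of_not_even hv, AffineMap.lineMap_apply]
    ring
  · have hv : Even (c v) := by tauto
    refine ⟨v, u, t, 1 - t, Sym2.eq_swap, hv, hu, (hG u v h).symm, h0, h1, by ring,
      fun h h' => ⟨h0' h, h1' h'⟩, ?_⟩
    simp [axisPoint_of_even hv, axisPoint_of_not_even hu, AffineMap.lineMap_apply]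
    ring

/-- A graph is planar if its vertices have distinct nonzero integer labels such that the absolute
values of the labels of adjacent vertices are consecutive. -/
theorem isPlanar_of_abs_eq_add_one (hc : Function.Injective c) (hc₀ : ∀ v, c v ≠ 0)
    (hG : ∀ u v, G.Adj u v → |c u| = |c v| + 1 ∨ |c v| = |c u| + 1) : G.IsPlanar := by
  refine ⟨fun v => axisPoint (c v), axisPoint_injective.comp hc,
    fun u v _ => Path.segment _ _, ?_, ?_, ?_⟩
  · intro u v h s t hst
    refine Subtype.ext (AffineMap.lineMap_injective ℝ ?_ hst)
    exact (axisPoint_injective.comp hc).ne h.ne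
  · intro u v h t ht0 ht1 w hw
    obtain ⟨a, b, x, y, -, -, -, -, -, -, -, hpos, heq⟩ := exists_segment_axisPoint_eq hG h t
    obtain ⟨hx, hy⟩ := hpos ht0 ht1
    have := axisPoint_fst_mul_snd (c w)
    rw [← show (x * (c a : ℝ), y * (c b : ℝ)) = axisPoint (c w) from heq.symm.trans hw] at this
    have h3 : (c a : ℝ) ≠ 0 := by exact_mod_cast hc₀ a
    have h4 : (c b : ℝ) ≠ 0 := by exact_mod_cast hc₀ b
    have : x * c a * (y * c b) ≠ 0 := by positivity
    contradiction
  · intro u v u' v' h h' hne s t hs0 hs1 heq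
    obtain ⟨a, b, x, y, hab, ha, hb, hcab, -, -, hxy, hpos, e⟩ :=
      exists_segment_axisPoint_eq hG h s
    obtain ⟨a', b', x', y', hab', ha', hb', hcab', hx', hy', hxy', -, e'⟩ :=
      exists_segment_axisPoint_eq hG h' t
    obtain ⟨hx, hy⟩ := hpos hs0 hs1
    rw [e, e', Prod.mk.injEq] at heq
    obtain ⟨h1, h2⟩ := eq_and_eq_of_mul_eq_mul ha hb ha' hb' (hc₀ a) hcab hcab' hx hy hxy
      hx' hy' hxy' heq.1 heq.2
    exact hne (by rw [hab, hab', hc h1, hc h2])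

theorem four_le_egirth_of_abs_eq_add_one
    (hG : ∀ u v, G.Adj u v → |c u| = |c v| + 1 ∨ |c v| = |c u| + 1) : 4 ≤ G.egirth := by
  classical
  let C : G.Coloring Bool := Coloring.mk (fun v => decide (Even (c v))) fun {u v} h => by
    rw [Ne, decide_eq_decide, ← even_abs, ← even_abs (a := c v)]
    obtain h | h := hG u v h <;> rw [h, Int.even_add_one] <;> tauto
  refine le_egirth.2 fun v p hp => ?_
  have h3 := hp.isCircuit.three_le_length
  have h2 := (C.even_length_iff_congr p).2 Iff.rfl
  rw [Nat.even_iff] at h2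
  exact_mod_cast (by omega : 4 ≤ p.length)

end SimpleGraph

/-- The position of `a` on the zigzag Hamiltonian path
`i, i + 1, i - 1, i + 2, i - 2, …, i + t` of the complete graph on the integers modulo `2 * t`. -/
def zigzagIndex (t i a : ℕ) : ℕ :=
  let d := (a + 2 * t - i) % (2 * t)
  if d = 0 then 0 else if d ≤ t then 2 * d - 1 else 2 * (2 * t - d)

theorem zigzagIndex_eq_of_le {t i a : ℕ} (ha : a < 2 * t) (hi : i ≤ a) :
    zigzagIndex t i a =
      if a = i then 0 else if a - i ≤ t then 2 * (a - i) - 1 else 2 * (2 * t - (a - i)) := by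
  have : (a + 2 * t - i) % (2 * t) = a - i := by
    rw [show a + 2 * t - i = a - i + 2 * t by omega, Nat.add_mod_right, Nat.mod_eq_of_lt (by omega)]
  simp only [zigzagIndex, this]
  congr 1
  simp only [eq_iff_iff]
  omega

theorem zigzagIndex_eq_of_lt {t i a : ℕ} (hi : i < t) (ha : a < i) :
    zigzagIndex t i a = 2 * (i - a) := by
  have : (a + 2 * t - i) % (2 * t) = a + 2 * t - i := Nat.mod_eq_of_lt (by omega)
  simp only [zigzagIndex, this]
  split_ifs <;> omega

theorem zigzagIndex_inj {t i a b : ℕ} (hi : i < t) (ha : a < 2 * t) (hb : b < 2 * t)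
    (h : zigzagIndex t i a = zigzagIndex t i b) : a = b := by
  obtain hai | hai := Nat.lt_or_ge a i <;> obtain hbi | hbi := Nat.lt_or_ge b i
  · rw [zigzagIndex_eq_of_lt hi hai, zigzagIndex_eq_of_lt hi hbi] at h
    omega
  · rw [zigzagIndex_eq_of_lt hi hai, zigzagIndex_eq_of_le hb hbi] at h
    split_ifs at h <;> omega
  · rw [zigzagIndex_eq_of_le ha hai, zigzagIndex_eq_of_lt hi hbi] at h
    split_ifs at h <;> omega
  · rw [zigzagIndex_eq_of_le ha hai, zigzagIndex_eq_of_le hb hbi] at h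
    split_ifs at h <;> omega

/-- The zigzag paths cover all edges of the complete graph. -/
theorem exists_zigzagIndex_eq_add_one {t a b : ℕ} (hab : a < b) (hb : b < 2 * t) :
    ∃ i < t, zigzagIndex t i a = zigzagIndex t i b + 1 ∨
      zigzagIndex t i b = zigzagIndex t i a + 1 := by
  obtain h | h := Nat.lt_or_ge (a + b) (2 * t)
  · refine ⟨(a + b) / 2, by omega, ?_⟩
    rw [zigzagIndex_eq_of_le hb (by omega)]
    obtain h' | h' := Nat.lt_or_ge a ((a + b) / 2)
    · rw [zigzagIndex_eq_of_lt (by omega) h']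
      split_ifs <;> omega
    · rw [zigzagIndex_eq_of_le (by omega) h']
      split_ifs <;> omega
  · refine ⟨(a + b) / 2 - t, by omega, ?_⟩
    rw [zigzagIndex_eq_of_le hb (by omega), zigzagIndex_eq_of_le (by omega) (by omega)]
    split_ifs <;> omega

/-- The label of the vertex `v` in the `i`-th part of the decomposition: the pair `{2a, 2a + 1}`
gets labels `k + 1` and `-(k + 1)`, where `k` is the position of `a` on the `i`-th zigzag path. -/
def zigzagLabel (t i v : ℕ) : ℤ :=
  if v % 2 = 0 then zigzagIndex t i (v / 2) + 1 else -(zigzagIndex t i (v / 2) + 1)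

theorem abs_zigzagLabel (t i v : ℕ) : |zigzagLabel t i v| = zigzagIndex t i (v / 2) + 1 := by
  rw [zigzagLabel]
  split_ifs
  · exact abs_of_nonneg (by positivity)
  · rw [abs_neg]
    exact abs_of_nonneg (by positivity)

theorem zigzagLabel_ne_zero (t i v : ℕ) : zigzagLabel t i v ≠ 0 := by
  rw [← abs_pos, abs_zigzagLabel]
  positivity

theorem zigzagLabel_inj {t i u v : ℕ} (hi : i < t) (hu : u < 4 * t) (hv : v < 4 * t)
    (h : zigzagLabel t i u = zigzagLabel t i v) : u = v := by
  have h1 := abs_zigzagLabel t i u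
  rw [h, abs_zigzagLabel] at h1
  have h2 : u / 2 = v / 2 := zigzagIndex_inj hi (by omega) (by omega) (by omega)
  have h3 : u % 2 = v % 2 := by
    simp only [zigzagLabel, h2] at h
    split_ifs at h <;> omega
  omega

/-- `t + 1` graphs that decompose the complete graph on `4 * t` vertices: a blown-up zigzag path
for each `i < t`, and a perfect matching. -/
def zigzagPart (t : ℕ) (i : Fin (t + 1)) : SimpleGraph (Fin (4 * t)) :=
  SimpleGraph.fromRel fun u v =>
    if (i : ℕ) < t then |zigzagLabel t i u| = |zigzagLabel t i v| + 1
    else (u : ℕ) / 2 = v / 2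

theorem zigzagPart_isPlanar_and_four_le_egirth (t : ℕ) (i : Fin (t + 1)) :
    (zigzagPart t i).IsPlanar ∧ 4 ≤ (zigzagPart t i).egirth := by
  by_cases hi : (i : ℕ) < t
  · have h : ∀ u v, (zigzagPart t i).Adj u v →
        |zigzagLabel t i u| = |zigzagLabel t i v| + 1 ∨
          |zigzagLabel t i v| = |zigzagLabel t i u| + 1 := by
      intro u v huv
      rw [zigzagPart, SimpleGraph.fromRel_adj] at huv
      simpa only [if_pos hi] using huv.2
    exact ⟨SimpleGraph.isPlanar_of_abs_eq_add_one
      (fun u v huv => Fin.ext (zigzagLabel_inj hi u.2 v.2 huv)) (fun v => zigzagLabel_ne_zero t i v) h,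
      SimpleGraph.four_le_egirth_of_abs_eq_add_one h⟩
  · have h : ∀ u v, (zigzagPart t i).Adj u v →
        |((u : ℕ) : ℤ) + 1| = |((v : ℕ) : ℤ) + 1| + 1 ∨
          |((v : ℕ) : ℤ) + 1| = |((u : ℕ) : ℤ) + 1| + 1 := by
      intro u v huv
      rw [zigzagPart, SimpleGraph.fromRel_adj] at huv
      simp only [if_neg hi] at huv
      rw [abs_of_nonneg (by positivity), abs_of_nonneg (by positivity)]
      obtain ⟨h1, h2⟩ := huv
      rw [Ne, Fin.ext_iff] at h1
      omega
    exact ⟨SimpleGraph.isPlanar_of_abs_eq_add_one (fun u v huv => Fin.ext (by simpa using huv))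
      (fun v => by positivity) h, SimpleGraph.four_le_egirth_of_abs_eq_add_one h⟩

theorem iSup_zigzagPart (t : ℕ) : ⨆ i, zigzagPart t i = ⊤ := by
  refine eq_top_iff.2 fun u v huv => ?_
  rw [SimpleGraph.iSup_adj]
  wlog hle : (u : ℕ) / 2 ≤ v / 2 generalizing u v
  · obtain ⟨i, hi⟩ := this v u huv.symm (by omega)
    exact ⟨i, hi.symm⟩
  obtain hlt | heq := hle.lt_or_eq
  · obtain ⟨i, hi, h⟩ := exists_zigzagIndex_eq_add_one hlt (t := t) (by omega)
    refine ⟨⟨i, by omega⟩, ?_⟩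
    rw [zigzagPart, SimpleGraph.fromRel_adj]
    refine ⟨huv, ?_⟩
    simp only [if_pos hi, abs_zigzagLabel]
    omega
  · refine ⟨Fin.last t, ?_⟩
    rw [zigzagPart, SimpleGraph.fromRel_adj]
    refine ⟨huv, .inl ?_⟩
    simpa using heq

theorem SimpleGraph.card_edgeFinset_iSup_le {V : Type*} [Fintype V] [DecidableEq V] {k m : ℕ}
    (f : Fin k → SimpleGraph V) [∀ i, Fintype (f i).edgeSet] [Fintype (⨆ i, f i).edgeSet]
    (h : ∀ i, (f i).edgeFinset.card ≤ m) : (⨆ i, f i).edgeFinset.card ≤ k * m := by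
  have hsub : (⨆ i, f i).edgeFinset ⊆ Finset.univ.biUnion fun i => (f i).edgeFinset := by
    intro e he
    rw [SimpleGraph.mem_edgeFinset] at he
    induction e with
    | h u v =>
      rw [SimpleGraph.mem_edgeSet, SimpleGraph.iSup_adj] at he
      simpa using he
  calc _ ≤ _ := Finset.card_le_card hsub
    _ ≤ Finset.card (Finset.univ : Finset (Fin k)) * m :=
      Finset.card_biUnion_le_card_mul _ _ _ fun i _ => h i
    _ = k * m := by rw [Finset.card_univ, Fintype.card_fin]

end

/-- For every `t ≥ 1`, the 4-girth-thickness of `K_{4t}` equals `t + 1`. -/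
theorem girth4Thickness_completeGraph_four_mul (t : ℕ) (ht : 1 ≤ t) :
    (⊤ : SimpleGraph (Fin (4 * t))).girth4Thickness = t + 1 := by
  classical
  have hmem : t + 1 ∈ {k | ∃ f : Fin k → SimpleGraph (Fin (4 * t)),
      (∀ i, (f i).IsPlanar ∧ 4 ≤ (f i).egirth) ∧ (⨆ i, f i) = ⊤} :=
    ⟨zigzagPart t, zigzagPart_isPlanar_and_four_le_egirth t, iSup_zigzagPart t⟩
  refine le_antisymm (Nat.sInf_le hmem) (le_csInf ⟨_, hmem⟩ ?_)
  rintro k ⟨f, hf, hsup⟩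
  have hle := SimpleGraph.card_edgeFinset_iSup_le f (m := 8 * t - 4) fun i => by
    have := (hf i).1.card_edgeFinset_add_four_le (hf i).2 (by rw [Fintype.card_fin]; omega)
    rw [Fintype.card_fin] at this
    omega
  have htop : (⨆ i, f i).edgeFinset.card = (4 * t).choose 2 := by
    rw [SimpleGraph.edgeFinset_inj.2 hsup, SimpleGraph.card_edgeFinset_top_eq_card_choose_two,
      Fintype.card_fin]
  rw [htop, Nat.choose_two_right] at hle
  by_contra! hk
  have hkt : k * (8 * t - 4) ≤ t * (8 * t - 4) := Nat.mul_le_mul_right _ (by omega)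
  obtain ⟨s, rfl⟩ : ∃ s, t = s + 1 := ⟨t - 1, by omega⟩
  rw [show 4 * (s + 1) - 1 = 4 * s + 3 by omega,
    show 4 * (s + 1) * (4 * s + 3) = 2 * (2 * (s + 1) * (4 * s + 3)) by ring,
    Nat.mul_div_cancel_left _ two_pos] at hle
  rw [show 8 * (s + 1) - 4 = 8 * s + 4 by omega] at hle hkt
  nlinarith
end
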